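/- Let X be a centered Gaussian process on [A,B] with almost surely twice continuously differentiable sample paths and twice continuously differentiable covariance. Assume the variance σ²(t) attains its maximum S at the unique point t₀ = A, that (σ²)′(A) = 0, and that ℙ(∂ₜX(A) = 0) < 1. Then there exist δ > 0, χ > 0, C > 0 and u₀ > 0 such that for all u ≥ u₀, |ℙ(max_{t∈[A,B]} |X(t)| ≥ u) − 2 ℙ(X(A) ≥ u) − 2 E[N_u^+(𝓜(δ))]| ≤ C e^{−u²(1+χ)/(2S)}. -/

import Mathlib

open MeasureTheory ProbabilityTheory Set
open scoped NNReal

section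
open scoped ENNReal

set_option linter.unusedSectionVars false

namespace GM

variable {Ω : Type*} [MeasurableSpace Ω] {P : Measure Ω} [IsProbabilityMeasure P] {T : Type*}

lemma gaussianProcess_of_lin (Z : T → Ω → ℝ) (hZ : ∀ t, Measurable (Z t))
    (hG : ∀ (n : ℕ) (c : Fin n → ℝ) (t : Fin n → T),
      ∃ v : ℝ≥0, P.map (fun ω => ∑ i, c i * Z (t i) ω) = gaussianReal 0 v) :
    IsGaussianProcess Z P where
  hasGaussianLaw I := by
    constructor
    refine isGaussian_of_map_eq_gaussianReal fun L => ?_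
    classical
    let e := I.equivFin
    obtain ⟨v, hv⟩ := hG I.card (fun i => L (Pi.single (e.symm i) 1)) (fun i => (e.symm i).1)
    refine ⟨0, v, ?_⟩
    have hm : Measurable (fun ω => I.restrict (Z · ω)) := measurable_pi_lambda _ fun i => hZ i
    rw [← hv, Measure.map_map (by fun_prop) hm]
    congr 1
    funext ω
    simp only [Function.comp_apply]
    rw [← L.sum_comp_single]
    rw [← e.symm.sum_comp]
    refine Finset.sum_congr rfl fun i _ => ?_
    simp only [ContinuousLinearMap.comp_apply, Finset.restrict, ContinuousLinearMap.single_apply]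
    have : (Pi.single (e.symm i) (Z (e.symm i) ω) : I → ℝ)
        = (Z (e.symm i) ω) • Pi.single (e.symm i) (1:ℝ) := by
      ext j; by_cases h : j = e.symm i
      · subst h; simp
      · simp [Pi.single_apply, h]
    rw [this, map_smul, smul_eq_mul, mul_comm]

/-- Finite linear combinations of the variables of a process. -/
noncomputable def hull (Z : T → Ω → ℝ) (c : T →₀ ℝ) (ω : Ω) : ℝ := c.sum fun t a => a * Z t ω

lemma hull_single (Z : T → Ω → ℝ) (t : T) (a : ℝ) (ω : Ω) :
    hull Z (Finsupp.single t a) ω = a * Z t ω := by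
  simp [hull]

lemma hull_add (Z : T → Ω → ℝ) (c d : T →₀ ℝ) (ω : Ω) :
    hull Z (c + d) ω = hull Z c ω + hull Z d ω := by
  classical
  exact Finsupp.sum_add_index' (by simp) (by intros; ring)

lemma hull_smul (Z : T → Ω → ℝ) (a : ℝ) (d : T →₀ ℝ) (ω : Ω) :
    hull Z (a • d) ω = a * hull Z d ω := by
  rw [hull, Finsupp.sum_smul_index (by simp), hull, Finsupp.mul_sum]
  simp [mul_assoc]

lemma hull_neg (Z : T → Ω → ℝ) (d : T →₀ ℝ) (ω : Ω) :
    hull Z (-d) ω = - hull Z d ω := by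
  have := hull_smul Z (-1) d ω
  simpa using this

lemma hull_sub (Z : T → Ω → ℝ) (c d : T →₀ ℝ) (ω : Ω) :
    hull Z (c - d) ω = hull Z c ω - hull Z d ω := by
  rw [sub_eq_add_neg, hull_add, hull_neg, sub_eq_add_neg]

lemma hull_zero (Z : T → Ω → ℝ) (ω : Ω) :
    hull Z 0 ω = 0 := by
  simp [hull]

lemma measurable_hull (Z : T → Ω → ℝ) (hZ : ∀ t, Measurable (Z t)) (c : T →₀ ℝ) :
    Measurable (hull Z c) := by
  unfold hull Finsupp.sum
  fun_prop

lemma hull_gaussian (Z : T → Ω → ℝ) (hG : IsGaussianProcess Z P) :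
    IsGaussianProcess (hull Z) P := by
  refine hG.of_isGaussianProcess fun c => ⟨c.support,
    ∑ i : c.support, (c i) • ContinuousLinearMap.proj i, fun ω => ?_⟩
  simp [hull, Finsupp.sum]
  exact (Finset.sum_attach c.support (fun x => c x * Z x ω)).symm

lemma hull_mean (Z : T → Ω → ℝ) (hG : IsGaussianProcess Z P) (h0 : ∀ t, ∫ ω, Z t ω ∂P = 0)
    (c : T →₀ ℝ) : ∫ ω, hull Z c ω ∂P = 0 := by
  unfold hull Finsupp.sum
  rw [integral_finsetSum]
  · simp [integral_const_mul, h0]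
  · intro t _
    exact (hG.hasGaussianLaw_eval t).integrable.const_mul _

end GM

end

section
open scoped ENNReal

set_option linter.unusedSectionVars false
namespace GM

variable {Ω : Type*} [MeasurableSpace Ω] {P : Measure Ω} [IsProbabilityMeasure P] {T : Type*}

open Filter Topology in
lemma fernique_family {ι : Type*} [Countable ι] [Nonempty ι] (η : ι → Ω → ℝ)
    (hm : ∀ k, Measurable (η k)) (hG : IsGaussianProcess η P) (h0 : ∀ k, ∫ ω, η k ω ∂P = 0)
    (hbdd : ∀ᵐ ω ∂P, BddAbove (range fun k => |η k ω|)) :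
    ∃ c > (0:ℝ), ∫⁻ ω, ENNReal.ofReal (Real.exp (c * (⨆ k, |η k ω|) ^ 2)) ∂P < ∞ := by
  classical
  -- choose the level
  obtain ⟨a, ha1, ha⟩ : ∃ a : ℝ, 0 < a ∧ (3/4 : ℝ≥0∞) ≤ P {ω | ∀ k, |η k ω| ≤ a} := by
    have hmono : Monotone (fun n : ℕ => {ω | ∀ k, |η k ω| ≤ (n:ℝ)}) := by
      intro n m hnm ω hω k
      exact (hω k).trans (by exact_mod_cast hnm)
    have h1 := tendsto_measure_iUnion_atTop (μ := P) hmono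
    have h2 : P (⋃ n : ℕ, {ω | ∀ k, |η k ω| ≤ (n:ℝ)}) = 1 := by
      rw [← measure_univ (μ := P)]
      apply measure_congr
      rw [eventuallyEq_univ]
      filter_upwards [hbdd] with ω ⟨M, hM⟩
      obtain ⟨n, hn⟩ := exists_nat_ge M
      exact mem_iUnion.2 ⟨n, fun k => (hM ⟨k, rfl⟩).trans hn⟩
    rw [h2] at h1
    have h3 : (3/4 : ℝ≥0∞) < 1 := by
      rw [ENNReal.div_lt_iff (by simp) (by simp)]; norm_num
    obtain ⟨n, hn, hn'⟩ := ((h1.eventually (lt_mem_nhds h3)).and (eventually_ge_atTop 1)).exists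
    exact ⟨n, by exact_mod_cast hn', hn.le⟩
  have h34 : (2:ℝ≥0∞)⁻¹ < 3/4 := by
    rw [ENNReal.lt_div_iff_mul_lt (by simp) (by simp)]
    have : (4:ℝ≥0∞) = 2 * 2 := by norm_num
    rw [this, ← mul_assoc, ENNReal.inv_mul_cancel (by simp) (by simp)]; norm_num
  have h341 : (3/4 : ℝ≥0∞) < 1 := by
    rw [ENNReal.div_lt_iff (by simp) (by simp)]; norm_num
  set κ : ℝ := Fernique.logRatio (3/4) * a⁻¹ ^ 2 with hκ
  have hκpos : 0 < κ := mul_pos (Fernique.logRatio_pos h34 h341) (by positivity)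
  set K : ℝ≥0∞ := .ofReal (Real.exp (Fernique.logRatio (3/4)))
        + ∑' n : ℕ, .ofReal (Real.exp (-2⁻¹ * Real.log ((3/4:ℝ≥0∞) / (1 - 3/4)).toReal * 2 ^ n)) with hK
  have hKfin : K < ∞ := by
    refine ENNReal.add_lt_top.mpr ⟨ENNReal.ofReal_lt_top, ?_⟩
    refine Summable.tsum_ofReal_lt_top <|
      Real.summable_exp_nat_mul_of_ge ?_ (fun i ↦ mod_cast (Nat.lt_pow_self (by simp)).le)
    refine mul_neg_of_neg_of_pos (by simp) (Real.log_pos ?_)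
    rw [ENNReal.toReal_div, ENNReal.toReal_sub_of_le h341.le (by simp), ENNReal.toReal_div]
    norm_num
  obtain ⟨f, hf⟩ := exists_surjective_nat ι
  let I : ℕ → Finset ι := fun n => (Finset.range n).image f
  let V : (n : ℕ) → Ω → (I n → ℝ) := fun n ω => (I n).restrict (η · ω)
  have hV : ∀ n, Measurable (V n) := fun n => measurable_pi_lambda _ fun i => hm i
  have hbound : ∀ n, ∫⁻ ω, ENNReal.ofReal (Real.exp (κ * ‖V n ω‖ ^ 2)) ∂P ≤ K := by
    intro n
    have hg := (hG.hasGaussianLaw (I n)).isGaussian_map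
    have hprob : IsProbabilityMeasure (P.map (V n)) := hg.toIsProbabilityMeasure
    have hmean : (P.map (V n))[id] = 0 := by
      rw [integral_map (hV n).aemeasurable (by fun_prop)]
      ext i
      have := (ContinuousLinearMap.proj (R := ℝ) (φ := fun _ : I n => ℝ) i).integral_comp_comm
        (φ := V n) (μ := P) (hG.hasGaussianLaw (I n)).integrable
      simp only [id]
      have h2 : (∫ ω, V n ω ∂P) i = ∫ ω, η i ω ∂P := by
        rw [← ContinuousLinearMap.proj_apply (R := ℝ) (φ := fun _ : I n => ℝ) i (∫ ω, V n ω ∂P), ← this]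
        rfl
      rw [h2, h0]; rfl
    have hrot := IsGaussian.map_rotation_eq_self (μ := P.map (V n)) hmean (-(Real.pi / 4))
    have hle : (3/4 : ℝ≥0∞) ≤ (P.map (V n)) {x | ‖x‖ ≤ a} := by
      rw [Measure.map_apply (hV n) (measurableSet_le measurable_norm measurable_const)]
      refine ha.trans (measure_mono fun ω hω => ?_)
      simp only [mem_preimage, mem_setOf_eq]
      rw [pi_norm_le_iff_of_nonneg ha1.le]
      exact fun i => hω i
    have := lintegral_exp_mul_sq_norm_le_of_map_rotation_eq_self hrot hle h34
    rwa [lintegral_map (by fun_prop) (hV n)] at this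
  refine ⟨κ, hκpos, lt_of_le_of_lt ?_ hKfin⟩
  calc ∫⁻ ω, ENNReal.ofReal (Real.exp (κ * (⨆ k, |η k ω|) ^ 2)) ∂P
      ≤ ∫⁻ ω, liminf (fun n => ENNReal.ofReal (Real.exp (κ * ‖V n ω‖ ^ 2))) atTop ∂P := by
        apply lintegral_mono_ae
        filter_upwards [hbdd] with ω hω
        have ht : Tendsto (fun n => ‖V n ω‖) atTop (𝓝 (⨆ k, |η k ω|)) := by
          refine tendsto_order.2 ⟨fun b hb => ?_, fun b hb => ?_⟩
          · obtain ⟨k, hk⟩ := exists_lt_of_lt_ciSup hb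
            obtain ⟨j, rfl⟩ := hf k
            filter_upwards [eventually_gt_atTop j] with n hn
            refine hk.trans_le ?_
            exact norm_le_pi_norm (V n ω) ⟨f j, Finset.mem_image_of_mem f (Finset.mem_range.2 hn)⟩
          · filter_upwards with n
            refine lt_of_le_of_lt ?_ hb
            rw [pi_norm_le_iff_of_nonneg (Real.iSup_nonneg fun k => abs_nonneg _)]
            exact fun i => le_ciSup hω i.1
        refine le_of_eq (Tendsto.liminf_eq ?_).symm
        exact (ENNReal.continuous_ofReal.tendsto _).comp
          ((Real.continuous_exp.tendsto _).comp ((ht.pow 2).const_mul κ))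
    _ ≤ liminf (fun n => ∫⁻ ω, ENNReal.ofReal (Real.exp (κ * ‖V n ω‖ ^ 2)) ∂P) atTop := by
        apply lintegral_liminf_le
        intro n
        have := hV n
        fun_prop
    _ ≤ K := by
        refine liminf_le_of_le (by isBoundedDefault) fun b hb => ?_
        obtain ⟨n, hn⟩ := hb.exists
        exact hn.trans (hbound n)

end GM

end

section
open scoped ENNReal

set_option linter.unusedSectionVars false

namespace GM

variable {Ω : Type*} [MeasurableSpace Ω] {P : Measure Ω} [IsProbabilityMeasure P] {T : Type*}

lemma gauss_small_ball0 {S u ρ E : ℝ} {v : ℝ≥0} (hS : 0 < S) (hv1 : S / 2 ≤ v)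
    (hρ : 0 ≤ ρ) (hE : ∀ x, |x - u| ≤ ρ → Real.exp (-x ^ 2 / (2 * v)) ≤ E) :
    gaussianReal 0 v {x | |x - u| ≤ ρ} ≤ ENNReal.ofReal (2 * ρ * (1 / √(Real.pi * S)) * E) := by
  have hv0 : v ≠ 0 := by
    rintro rfl; simp at hv1; linarith
  have hset : {x : ℝ | |x - u| ≤ ρ} = Icc (u - ρ) (u + ρ) := by
    ext x; simp only [Set.mem_ofPred_eq, mem_Icc, abs_le]; constructor <;> rintro ⟨h1, h2⟩ <;> constructor <;> linarith
  have hE0 : 0 ≤ E := le_trans (Real.exp_pos _).le (hE u (by simpa using hρ))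
  have hpi : 0 < Real.pi * S := by positivity
  rw [gaussianReal_apply 0 hv0]
  calc ∫⁻ x in {x | |x - u| ≤ ρ}, gaussianPDF 0 v x
      ≤ ∫⁻ x in {x | |x - u| ≤ ρ}, ENNReal.ofReal ((1 / √(Real.pi * S)) * E) := by
        refine setLIntegral_mono (by fun_prop) fun x hx => ?_
        rw [gaussianPDF]
        refine ENNReal.ofReal_le_ofReal ?_
        rw [gaussianPDFReal_def]
        have h1 : (√(2 * Real.pi * v))⁻¹ ≤ 1 / √(Real.pi * S) := by
          rw [one_div]
          refine inv_anti₀ (Real.sqrt_pos.2 hpi) (Real.sqrt_le_sqrt ?_)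
          nlinarith [Real.pi_pos]
        have h2 := hE x hx
        simp only [sub_zero]
        gcongr
    _ = _ := by
        rw [setLIntegral_const, hset, Real.volume_Icc, ← ENNReal.ofReal_mul (by positivity)]
        congr 1; ring

lemma gauss_small_ball {S u ρ ε : ℝ} {v : ℝ≥0} (hS : 0 < S) (hv1 : S / 2 ≤ v) (hv2 : v ≤ S)
    (hu : 0 < u) (hε : 0 < ε) (hε1 : ε < 1) (hρ : 0 ≤ ρ) :
    gaussianReal 0 v {x | |x - u| ≤ ρ} ≤ ENNReal.ofReal (2 * ρ * (1 / √(Real.pi * S)) *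
      (Real.exp (-((1 - ε) ^ 2 * u ^ 2) / (2 * S)) + ρ / (ε * u))) := by
  have hv0 : (0:ℝ) < v := by linarith
  refine gauss_small_ball0 hS hv1 hρ fun x hx => ?_
  have hpos : 0 ≤ ρ / (ε * u) := by positivity
  by_cases h : ρ ≤ ε * u
  · refine le_trans ?_ (le_add_of_nonneg_right hpos)
    apply Real.exp_le_exp.2
    have hx1 : (1 - ε) * u ≤ x := by
      have := (abs_le.1 hx).1; linarith
    have h2 : ((1 - ε) * u) ^ 2 ≤ x ^ 2 := by
      have : 0 ≤ (1 - ε) * u := mul_nonneg (by linarith) hu.le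
      gcongr
    rw [neg_div, neg_div, neg_le_neg_iff, ← mul_pow]
    gcongr
  · push Not at h
    have h1 : 1 ≤ ρ / (ε * u) := by
      rw [le_div_iff₀ (by positivity)]; linarith
    have h2 : Real.exp (-x ^ 2 / (2 * v)) ≤ 1 := by
      rw [Real.exp_le_one_iff, neg_div]
      have : 0 ≤ x ^ 2 / (2 * v) := by positivity
      linarith
    linarith [Real.exp_pos (-((1 - ε) ^ 2 * u ^ 2) / (2 * S))]

lemma hull_indep {ι : Type*} (Z : T → Ω → ℝ) (hZ : ∀ t, Measurable (Z t))
    (hG : IsGaussianProcess Z P) (h0 : ∀ t, ∫ ω, Z t ω ∂P = 0)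
    (d : ι → T →₀ ℝ) (x : T →₀ ℝ) (h : ∀ k, ∫ ω, hull Z (d k) ω * hull Z x ω ∂P = 0) :
    IndepFun (fun ω k => hull Z (d k) ω) (hull Z x) P := by
  have hH := hull_gaussian Z hG
  have h1 : IsGaussianProcess (Sum.elim (fun k => hull Z (d k)) (fun _ : Unit => hull Z x)) P := by
    have := hH.comp_right (Sum.elim d (fun _ : Unit => x))
    have he : (Sum.elim (fun k => hull Z (d k)) (fun _ : Unit => hull Z x))
        = hull Z ∘ Sum.elim d fun _ => x := by
      funext k; cases k <;> rfl
    rw [he]; exact this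
  have h2 := h1.indepFun_of_covariance_eq_zero (fun k => (measurable_hull Z hZ _).aemeasurable)
    (fun k => (measurable_hull Z hZ _).aemeasurable) (fun k _ => by
      rw [covariance_eq_sub (hH.hasGaussianLaw_eval _).memLp_two (hH.hasGaussianLaw_eval _).memLp_two]
      simp only [hull_mean Z hG h0, mul_zero, sub_zero]
      exact h k)
  exact h2.comp measurable_id (measurable_pi_apply ())

lemma indep_prob_le {R ξ : Ω → ℝ} (hR : Measurable R) (hξ : Measurable ξ) (hI : IndepFun R ξ P)
    (s : Set (ℝ × ℝ)) (hs : MeasurableSet s) :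
    P {ω | (R ω, ξ ω) ∈ s} = ∫⁻ ω, (P.map ξ) {x | (R ω, x) ∈ s} ∂P := by
  have h1 := (indepFun_iff_map_prod_eq_prod_map_map hR.aemeasurable hξ.aemeasurable).1 hI
  have : P {ω | (R ω, ξ ω) ∈ s} = (P.map (fun ω => (R ω, ξ ω))) s := by
    rw [Measure.map_apply (hR.prodMk hξ) hs]; rfl
  have hp := Measure.isProbabilityMeasure_map (μ := P) hξ.aemeasurable
  rw [this, h1, Measure.prod_apply hs, lintegral_map (measurable_measure_prodMk_left hs) hR]
  rfl

lemma abs_le_iSup {ι : Type*} {f : ι → ℝ} (h : BddAbove (range fun k => |f k|)) (k : ι) :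
    |f k| ≤ ⨆ k, |f k| := le_ciSup h k

/-- The key local estimate. -/
lemma key_local {ι : Type*} [Countable ι] [Nonempty ι]
    (Z : T → Ω → ℝ) (hZ : ∀ t, Measurable (Z t))
    (hG : IsGaussianProcess Z P) (h0 : ∀ t, ∫ ω, Z t ω ∂P = 0)
    (e : ι → T →₀ ℝ) (x : T →₀ ℝ) (W : Ω → ℝ) (hW : ∀ ω, W ω = ⨆ k, |hull Z (e k) ω|)
    (hbdd : ∀ᵐ ω ∂P, BddAbove (range fun k => |hull Z (e k) ω|))
    (hxW : ∀ᵐ ω ∂P, |hull Z x ω| ≤ W ω)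
    {S m L u ε h : ℝ} (hS : 0 < S) (hm : 0 < m) (hL : 0 ≤ L) (hu : 0 < u)
    (hε : 0 < ε) (hε1 : ε < 1) (hh : 0 < h) (hh1 : L + m / (2 * S) ≤ 1 / (4 * h))
    (hv1 : S / 2 ≤ ∫ ω, hull Z x ω * hull Z x ω ∂P) (hv2 : ∫ ω, hull Z x ω * hull Z x ω ∂P ≤ S)
    (hLk : ∀ k, |∫ ω, hull Z (e k) ω * hull Z x ω ∂P| ≤ L * ∫ ω, hull Z x ω * hull Z x ω ∂P)
    (J : Set ι) (hJ : ∀ k ∈ J, ∫ ω, hull Z (e k) ω * hull Z x ω ∂P ≤ - m) :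
    P {ω | |hull Z x ω - u| ≤ h * W ω ∧ ∃ k ∈ J, 0 < hull Z (e k) ω} ≤
      ∫⁻ ω, {ω | m * u / (2 * S) ≤ (1 + L) * W ω}.indicator (fun ω => ENNReal.ofReal
        (2 * (2 * h * (L * u + (1 + L) * W ω)) * (1 / √(Real.pi * S)) *
        (Real.exp (-((1 - ε) ^ 2 * u ^ 2) / (2 * S)) +
          (2 * h * (L * u + (1 + L) * W ω)) / (ε * u)))) ω ∂P := by
  have hH := hull_gaussian Z hG
  set ξ := hull Z x with hξ
  set V := ∫ ω, ξ ω * ξ ω ∂P with hV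
  have hV0 : 0 < V := by linarith
  set a : ι → ℝ := fun k => (∫ ω, hull Z (e k) ω * ξ ω ∂P) / V with ha
  have haL : ∀ k, |a k| ≤ L := fun k => by
    rw [ha, abs_div, abs_of_pos hV0, div_le_iff₀ hV0]; exact hLk k
  have hinteg : ∀ c d : T →₀ ℝ, Integrable (fun ω => hull Z c ω * hull Z d ω) P := fun c d =>
    (hH.hasGaussianLaw_eval c).memLp_two.integrable_mul (hH.hasGaussianLaw_eval d).memLp_two
  set d : ι → T →₀ ℝ := fun k => e k - a k • x with hd
  have hdv : ∀ k ω, hull Z (d k) ω = hull Z (e k) ω - a k * ξ ω := fun k ω => by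
    rw [hd, hull_sub, hull_smul]
  have horth : ∀ k, ∫ ω, hull Z (d k) ω * hull Z x ω ∂P = 0 := fun k => by
    have : ∀ ω, hull Z (d k) ω * hull Z x ω =
        hull Z (e k) ω * hull Z x ω - a k * (hull Z x ω * hull Z x ω) := fun ω => by
      rw [hdv]; ring
    simp_rw [this]
    rw [integral_sub (hinteg _ _) ((hinteg _ _).const_mul _), integral_const_mul]
    have : a k * V = ∫ ω, hull Z (e k) ω * ξ ω ∂P := by
      simp only [ha]; field_simp
    linarith
  have hind0 := hull_indep Z hZ hG h0 d x horth
  set R : Ω → ℝ := fun ω => ⨆ k, |hull Z (d k) ω| with hR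
  have hφ : Measurable (fun y : ι → ℝ => ⨆ k, |y k|) :=
    Measurable.iSup fun k => (measurable_pi_apply k).abs
  have hind : IndepFun R ξ P := hind0.comp hφ measurable_id
  have hRm : Measurable R := Measurable.iSup fun k => (measurable_hull Z hZ _).abs
  have hξm : Measurable ξ := measurable_hull Z hZ _
  have hae : ∀ᵐ ω ∂P, BddAbove (range fun k => |hull Z (d k) ω|) ∧ R ω ≤ (1 + L) * W ω ∧
      W ω ≤ L * |ξ ω| + R ω := by
    filter_upwards [hbdd, hxW] with ω hb hx
    have hk : ∀ k, |hull Z (d k) ω| ≤ (1 + L) * W ω := fun k => by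
      rw [hdv]
      have h1 : |hull Z (e k) ω| ≤ W ω := by rw [hW]; exact abs_le_iSup hb k
      calc _ ≤ |hull Z (e k) ω| + |a k * ξ ω| := abs_sub _ _
        _ ≤ W ω + L * W ω := by
          rw [abs_mul]
          have := haL k
          gcongr
        _ = _ := by ring
    have hb' : BddAbove (range fun k => |hull Z (d k) ω|) := ⟨_, by rintro _ ⟨k, rfl⟩; exact hk k⟩
    refine ⟨hb', ciSup_le hk, ?_⟩
    rw [hW]
    refine ciSup_le fun k => ?_
    have h1 : hull Z (e k) ω = a k * ξ ω + hull Z (d k) ω := by rw [hdv]; ring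
    rw [h1]
    calc _ ≤ |a k * ξ ω| + |hull Z (d k) ω| := abs_add_le _ _
      _ ≤ _ := by
        rw [abs_mul]
        have := haL k
        have := abs_le_iSup hb' k
        gcongr
  set s : Set (ℝ × ℝ) := {p | m * u / (2 * S) ≤ p.1 ∧ |p.2 - u| ≤ 2 * h * (L * u + p.1)} with hs
  have hsm : MeasurableSet s := by
    have h1 : MeasurableSet {p : ℝ × ℝ | m * u / (2 * S) ≤ p.1} :=
      measurableSet_le (by fun_prop) (by fun_prop)
    have h2 : MeasurableSet {p : ℝ × ℝ | |p.2 - u| ≤ 2 * h * (L * u + p.1)} :=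
      measurableSet_le (by fun_prop) (by fun_prop)
    exact h1.inter h2
  have hhL : h * L ≤ 1 / 4 := by
    have h1 : L ≤ 1 / (4 * h) := le_trans (le_add_of_nonneg_right (by positivity)) hh1
    rw [le_div_iff₀ (by positivity)] at h1
    linarith
  have hstep1 : P {ω | |hull Z x ω - u| ≤ h * W ω ∧ ∃ k ∈ J, 0 < hull Z (e k) ω} ≤
      P {ω | (R ω, ξ ω) ∈ s} := by
    refine measure_mono_ae ?_
    filter_upwards [hae] with ω ⟨hb, h1, h2⟩ ⟨h3, k, hkJ, hk⟩
    have hRk := abs_le_iSup hb k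
    have hR0 : 0 ≤ R ω := le_trans (abs_nonneg _) hRk
    have h4 : |ξ ω - u| ≤ 2 * h * (L * u + R ω) := by
      have h5 : |ξ ω| ≤ |ξ ω - u| + u := by
        have := abs_add_le (ξ ω - u) u
        rwa [sub_add_cancel, abs_of_pos hu] at this
      have h6 : |ξ ω - u| ≤ h * (L * (|ξ ω - u| + u) + R ω) := by
        refine h3.trans ?_
        gcongr
        exact h2.trans (by gcongr)
      nlinarith [abs_nonneg (ξ ω - u), mul_le_mul_of_nonneg_right hhL (abs_nonneg (ξ ω - u))]
    refine ⟨?_, h4⟩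
    by_cases hc : u / 2 ≤ ξ ω
    · have h7 : a k ≤ - (m / S) := by
        have h8 : m / S ≤ m / V := by gcongr
        have h9 : a k ≤ (-m) / V := by
          simp only [ha]; gcongr; exact hJ k hkJ
        rw [neg_div] at h9; linarith
      have h10 : hull Z (e k) ω = a k * ξ ω + hull Z (d k) ω := by rw [hdv]; ring
      have h11 : hull Z (d k) ω ≤ R ω := le_trans (le_abs_self _) hRk
      have h12 : a k * ξ ω ≤ - (m / S) * (u / 2) := by
        have : 0 < m / S := by positivity
        nlinarith
      have : m * u / (2 * S) = (m / S) * (u / 2) := by field_simp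
      change m * u / (2 * S) ≤ R ω
      rw [this]; linarith
    · push Not at hc
      have h13 : u / 2 ≤ |ξ ω - u| := by
        rw [abs_sub_comm]; exact le_trans (by linarith) (le_abs_self _)
      have h14 : u / (4 * h) ≤ L * u + R ω := by
        rw [div_le_iff₀ (by positivity)]; nlinarith
      have h15 : (L + m / (2 * S)) * u ≤ u / (4 * h) := by
        calc _ ≤ 1 / (4 * h) * u := by gcongr
          _ = _ := by ring
      have : m * u / (2 * S) = m / (2 * S) * u := by ring
      change m * u / (2 * S) ≤ R ω
      rw [this]; linarith
  refine hstep1.trans ?_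
  rw [indep_prob_le hRm hξm hind s hsm]
  obtain ⟨v, hv⟩ : ∃ v : ℝ≥0, P.map ξ = gaussianReal 0 v ∧ (v : ℝ) = V := by
    have h1 := (hH.hasGaussianLaw_eval x).map_eq_gaussianReal
    rw [hull_mean Z hG h0] at h1
    refine ⟨_, h1, ?_⟩
    rw [Real.coe_toNNReal _ (variance_nonneg _ _), variance_eq_sub (hH.hasGaussianLaw_eval x).memLp_two,
      hull_mean Z hG h0]
    simp only [hV, Pi.pow_apply, sq, hξ, mul_zero, sub_zero]
  refine lintegral_mono_ae ?_
  filter_upwards [hae] with ω ⟨hb, h1, h2⟩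
  obtain ⟨k⟩ := ‹Nonempty ι›
  have hR0 : 0 ≤ R ω := le_trans (abs_nonneg _) (abs_le_iSup hb k)
  by_cases hc : m * u / (2 * S) ≤ R ω
  · rw [Set.indicator_of_mem (show ω ∈ {ω | m * u / (2 * S) ≤ (1 + L) * W ω} from hc.trans h1)]
    have h3 : {y | (R ω, y) ∈ s} = {y | |y - u| ≤ 2 * h * (L * u + R ω)} := by
      ext y; simp [hs, hc]
    rw [h3, hv.1]
    refine (gauss_small_ball hS (by rw [hv.2]; exact hv1) (by rw [hv.2]; exact hv2) hu hε hε1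
      (by positivity)).trans ?_
    refine ENNReal.ofReal_le_ofReal ?_
    have hWW : 0 ≤ (1 + L) * W ω := hR0.trans h1
    gcongr
  · have h3 : {y | (R ω, y) ∈ s} = ∅ := by
      ext y; simp [hs, hc]
    rw [h3]; simp

end GM

end

section
open scoped ENNReal

set_option linter.unusedSectionVars false

namespace GM

variable {Ω : Type*} [MeasurableSpace Ω] {P : Measure Ω} [IsProbabilityMeasure P] {T : Type*}

lemma encard_le_of_nat (s : Set ℝ) (L : ℝ≥0∞)
    (h : ∀ t : Finset ℝ, ↑t ⊆ s → (t.card : ℝ≥0∞) ≤ L) : (s.encard : ℝ≥0∞) ≤ L := by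
  by_cases hs : s.Finite
  · have := h hs.toFinset (by simp)
    rwa [hs.encard_eq_coe_toFinset_card, ENat.toENNReal_coe]
  · have hs' : s.Infinite := hs
    have : L = ⊤ := by
      refine ENNReal.eq_top_of_forall_nnreal_le fun r => ?_
      obtain ⟨n, hn⟩ := exists_nat_ge r
      obtain ⟨t, ht, htc⟩ := hs'.exists_subset_card_eq n
      have := h t ht
      rw [htc] at this
      refine le_trans ?_ this
      exact_mod_cast hn
    rw [this]; exact le_top

/-- grid point -/
noncomputable def grid (A b : ℝ) (n i : ℕ) : ℝ := A + i * ((b - A) / (n + 1))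

lemma grid_mem {A b : ℝ} (hAb : A < b) (n i : ℕ) (hi : i < n + 1) : grid A b n i ∈ Icc A b := by
  unfold grid
  have h1 : (i : ℝ) ≤ n + 1 := by exact_mod_cast hi.le
  have h2 : 0 < b - A := by linarith
  have h3 : (0:ℝ) < n + 1 := by positivity
  constructor
  · have : 0 ≤ (i:ℝ) * ((b - A) / (n + 1)) := by positivity
    linarith
  · have : (i:ℝ) * ((b - A) / (n + 1)) ≤ (n + 1) * ((b - A) / (n + 1)) := by gcongr
    have h4 : ((n:ℝ) + 1) * ((b - A) / (n + 1)) = b - A := by field_simp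
    linarith

lemma exists_grid {A b : ℝ} (hAb : A < b) (n : ℕ) {t : ℝ} (ht : t ∈ Icc A b) :
    ∃ i < n + 1, grid A b n i ≤ t ∧ t ≤ grid A b n i + (b - A) / (n + 1) := by
  set h := (b - A) / (n + 1) with hh
  have h2 : 0 < b - A := by linarith
  have h3 : (0:ℝ) < n + 1 := by positivity
  have hpos : 0 < h := by positivity
  have hmul : (n + 1) * h = b - A := by rw [hh]; field_simp
  rcases eq_or_lt_of_le ht.2 with htb | htb
  · refine ⟨n, by omega, ?_⟩
    unfold grid
    rw [← hh]
    constructor <;> nlinarith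
  · have h0 : 0 ≤ (t - A) / h := div_nonneg (by linarith [ht.1]) hpos.le
    refine ⟨⌊(t - A) / h⌋₊, ?_, ?_⟩
    · rw [Nat.floor_lt h0, div_lt_iff₀ hpos]
      push_cast; linarith
    · have h4 := Nat.floor_le h0
      have h5 := Nat.lt_floor_add_one ((t - A) / h)
      rw [le_div_iff₀ hpos] at h4
      rw [div_lt_iff₀ hpos] at h5
      unfold grid
      rw [← hh]
      constructor <;> linarith

lemma encard_le_liminf {A b W u : ℝ} (hAb : A < b) (f : ℝ → ℝ)
    (hLip : ∀ s ∈ Icc A b, ∀ t ∈ Icc A b, |f s - f t| ≤ W * |s - t|) :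
    (({t ∈ Icc A b | f t = u}.encard : ℕ∞) : ℝ≥0∞) ≤
      Filter.liminf (fun n : ℕ => ∑ i ∈ Finset.range (n + 1),
        ({x : ℝ | |x - u| ≤ ((b - A) / (n + 1)) * W}.indicator (fun _ => (1 : ℝ≥0∞))
          (f (grid A b n i)))) Filter.atTop := by
  classical
  have hW : 0 ≤ W := by
    have := hLip A ⟨le_rfl, hAb.le⟩ b ⟨hAb.le, le_rfl⟩
    have h1 : 0 ≤ W * |A - b| := le_trans (abs_nonneg _) this
    have h2 : 0 < |A - b| := abs_pos.2 (by linarith)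
    nlinarith
  refine encard_le_of_nat _ _ fun F hF => ?_
  refine Filter.le_liminf_of_le (by isBoundedDefault) ?_
  -- minimal separation
  have hsep : ∃ d > 0, ∀ x ∈ F, ∀ y ∈ F, x ≠ y → d ≤ |x - y| := by
    by_cases hne : (F.offDiag).Nonempty
    · obtain ⟨p, hp, hpm⟩ := Finset.exists_min_image F.offDiag (fun p => |p.1 - p.2|) hne
      rw [Finset.mem_offDiag] at hp
      refine ⟨|p.1 - p.2|, abs_pos.2 (sub_ne_zero.2 hp.2.2), fun x hx y hy hxy => ?_⟩
      exact hpm (x, y) (Finset.mem_offDiag.2 ⟨hx, hy, hxy⟩)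
    · refine ⟨1, one_pos, fun x hx y hy hxy => ?_⟩
      exact absurd ⟨(x, y), Finset.mem_offDiag.2 ⟨hx, hy, hxy⟩⟩ hne
  obtain ⟨d, hd, hsep⟩ := hsep
  obtain ⟨n0, hn0⟩ := exists_nat_gt ((b - A) / d)
  filter_upwards [Filter.eventually_ge_atTop n0] with n hn
  have h3 : (0:ℝ) < n + 1 := by positivity
  have hpos : 0 < (b - A) / (n + 1) := div_pos (by linarith) h3
  have hhd : (b - A) / (n + 1) < d := by
    rw [div_lt_iff₀ hd] at hn0
    rw [div_lt_iff₀ h3]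
    have : (n0 : ℝ) ≤ n := by exact_mod_cast hn
    nlinarith
  have hch : ∀ t : ℝ, ∃ i, t ∈ F → (i < n + 1 ∧ grid A b n i ≤ t ∧
      t ≤ grid A b n i + (b - A) / (n + 1)) := fun t => by
    by_cases ht : t ∈ F
    · obtain ⟨i, hi⟩ := exists_grid hAb n (hF ht).1
      exact ⟨i, fun _ => hi⟩
    · exact ⟨0, fun h => absurd h ht⟩
  choose g hg using hch
  have hinj : Set.InjOn g F := by
    intro x hx y hy hxy
    by_contra hne
    have h1 := hsep x hx y hy hne
    have h2 := hg x hx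
    have h4 := hg y hy
    rw [hxy] at h2
    have : |x - y| ≤ (b - A) / (n + 1) := by rw [abs_le]; constructor <;> linarith [h2.2.1, h2.2.2, h4.2.1, h4.2.2]
    linarith
  calc (F.card : ℝ≥0∞) = ∑ i ∈ F.image g, 1 := by
        rw [Finset.sum_const, Finset.card_image_of_injOn hinj]; simp
    _ ≤ ∑ i ∈ F.image g, ({x : ℝ | |x - u| ≤ ((b - A) / (n + 1)) * W}.indicator
          (fun _ => (1 : ℝ≥0∞)) (f (grid A b n i))) := by
        refine Finset.sum_le_sum fun i hi => ?_
        obtain ⟨t, ht, rfl⟩ := Finset.mem_image.1 hi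
        obtain ⟨h1, h2, h4⟩ := hg t ht
        rw [Set.indicator_of_mem]
        have h5 := hLip _ (grid_mem hAb n _ h1) t (hF ht).1
        rw [(hF ht).2] at h5
        refine h5.trans ?_
        rw [mul_comm]
        gcongr
        rw [abs_le]; constructor <;> linarith
    _ ≤ _ := by
        refine Finset.sum_le_sum_of_subset ?_
        intro i hi
        obtain ⟨t, ht, rfl⟩ := Finset.mem_image.1 hi
        exact Finset.mem_range.2 (hg t ht).1

lemma le_exp_sq {c : ℝ} (hc : 0 < c) (x : ℝ) : x ≤ (1 / c + 1) * Real.exp (c / 2 * x ^ 2) := by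
  have h1 := Real.add_one_le_exp (c / 2 * x ^ 2)
  have h2 : (1 / c + 1) * (c / 2 * x ^ 2 + 1) = x ^ 2 / 2 + c / 2 * x ^ 2 + 1 / c + 1 := by
    field_simp; ring
  have h3 : (1 / c + 1) * (c / 2 * x ^ 2 + 1) ≤ (1 / c + 1) * Real.exp (c / 2 * x ^ 2) := by gcongr
  have h4 : 0 ≤ c / 2 * x ^ 2 := by positivity
  have h5 : 0 < 1 / c := by positivity
  nlinarith [sq_nonneg (x - 1)]

set_option maxHeartbeats 1000000 in
lemma zc_bound (X : ℝ → Ω → ℝ) (hX : ∀ t, Measurable (X t)) {A b S m L h0 c : ℝ} (hAb : A < b)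
    (hS : 0 < S) (hm : 0 < m) (hL : 0 ≤ L) (hh0 : 0 < h0) (hc : 0 < c)
    (W : Ω → ℝ) (hWm : Measurable W)
    (hLip : ∀ᵐ ω ∂P, ∀ s ∈ Icc A b, ∀ t ∈ Icc A b, |X s ω - X t ω| ≤ W ω * |s - t|)
    (hK : ∫⁻ ω, ENNReal.ofReal (Real.exp (c * (W ω) ^ 2)) ∂P < ∞)
    (F : Set Ω) (hF : MeasurableSet F)
    (hkey : ∀ u > 0, ∀ ε > 0, ε < 1 → ∀ h > 0, h ≤ h0 → ∀ t ∈ Icc A b,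
      P ({ω | |X t ω - u| ≤ h * W ω} ∩ F) ≤
      ∫⁻ ω, {ω | m * u / (2 * S) ≤ (1 + L) * W ω}.indicator (fun ω => ENNReal.ofReal
        (2 * (2 * h * (L * u + (1 + L) * W ω)) * (1 / √(Real.pi * S)) *
        (Real.exp (-((1 - ε) ^ 2 * u ^ 2) / (2 * S)) +
          (2 * h * (L * u + (1 + L) * W ω)) / (ε * u)))) ω ∂P) :
    ∃ χ > 0, ∃ C > 0, ∀ u > 0,
      ∫⁻ ω, F.indicator (fun ω => (({t ∈ Icc A b | X t ω = u}.encard : ℕ∞) : ℝ≥0∞)) ω ∂P ≤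
        ENNReal.ofReal (C * Real.exp (-(u ^ 2) * (1 + χ) / (2 * S))) := by
  set K := ∫⁻ ω, ENNReal.ofReal (Real.exp (c * (W ω) ^ 2)) ∂P with hKdef
  set q := m / (2 * S * (1 + L)) with hq
  have hq0 : 0 < q := by positivity
  set c1 := 1 / √(Real.pi * S) with hc1
  have hc10 : 0 < c1 := by positivity
  set κ := 1 / c + 1 with hκ
  have hκ0 : 0 < κ := by positivity
  have hba : 0 < b - A := by linarith
  set k1 := L / q + (1 + L) with hk1
  have hk10 : 0 < k1 := by positivity
  refine ⟨S * c * q ^ 2 / 2, by positivity, 4 * (b - A) * c1 * k1 * κ * (K.toReal + 1),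
    by positivity, fun u hu => ?_⟩
  set ε := min (1 / 2) (S * c * q ^ 2 / 4) with hε
  have hε0 : 0 < ε := by rw [hε]; positivity
  have hε1 : ε < 1 := lt_of_le_of_lt (min_le_left _ _) (by norm_num)
  have hε2 : ε ≤ S * c * q ^ 2 / 4 := min_le_right _ _
  set E := Real.exp (-((1 - ε) ^ 2 * u ^ 2) / (2 * S)) with hE
  set f : Ω → ℝ≥0∞ := fun ω => {ω | m * u / (2 * S) ≤ (1 + L) * W ω}.indicator (fun ω =>
    ENNReal.ofReal (4 * (b - A) * c1 * E * (L * u + (1 + L) * W ω))) ω with hf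
  set g : Ω → ℝ≥0∞ := fun ω => ENNReal.ofReal (8 * (b - A) * c1 / (ε * u) * (L * u + (1 + L) * W ω) ^ 2)
    with hg
  have hSm : MeasurableSet {ω | m * u / (2 * S) ≤ (1 + L) * W ω} :=
    measurableSet_le (by fun_prop) (by fun_prop)
  have hfm : Measurable f := Measurable.indicator (by fun_prop) hSm
  have hgm : Measurable g := by fun_prop
  -- bound of f
  have hfbound : ∫⁻ ω, f ω ∂P ≤ ENNReal.ofReal (4 * (b - A) * c1 * k1 * κ * (K.toReal + 1) *
      Real.exp (-(u ^ 2) * (1 + S * c * q ^ 2 / 2) / (2 * S))) := by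
    have h1 : ∀ ω, f ω ≤ ENNReal.ofReal (4 * (b - A) * c1 * k1 * κ *
        Real.exp (-(u ^ 2) * (1 + S * c * q ^ 2 / 2) / (2 * S))) *
        ENNReal.ofReal (Real.exp (c * (W ω) ^ 2)) := by
      intro ω
      rw [← ENNReal.ofReal_mul (by positivity)]
      by_cases hω : m * u / (2 * S) ≤ (1 + L) * W ω
      · simp only [hf]
        rw [Set.indicator_of_mem (show ω ∈ {ω | m * u / (2 * S) ≤ (1 + L) * W ω} from hω)]
        refine ENNReal.ofReal_le_ofReal ?_
        have hqu : q * u ≤ W ω := by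
          have : m * u / (2 * S) = (q * u) * (1 + L) := by rw [hq]; field_simp
          rw [this, mul_comm (1 + L)] at hω
          exact le_of_mul_le_mul_right hω (by linarith)
        have hW0 : 0 < W ω := lt_of_lt_of_le (by positivity) hqu
        have h2 : L * u + (1 + L) * W ω ≤ k1 * W ω := by
          have : L * u ≤ L / q * W ω := by
            calc L * u = L / q * (q * u) := by field_simp
              _ ≤ _ := by gcongr
          rw [hk1]; linarith
        have h3 := le_exp_sq hc (W ω)
        have h4 : Real.exp (c / 2 * W ω ^ 2) ≤ Real.exp (c * W ω ^ 2) *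
            Real.exp (- (c / 2 * (q * u) ^ 2)) := by
          rw [← Real.exp_add]
          apply Real.exp_le_exp.2
          have : (q * u) ^ 2 ≤ W ω ^ 2 := by gcongr
          nlinarith
        have h5 : E * Real.exp (- (c / 2 * (q * u) ^ 2)) ≤
            Real.exp (-(u ^ 2) * (1 + S * c * q ^ 2 / 2) / (2 * S)) := by
          rw [hE, ← Real.exp_add]
          apply Real.exp_le_exp.2
          have e1 : -((1 - ε) ^ 2 * u ^ 2) / (2 * S) + -(c / 2 * (q * u) ^ 2) =
            -(u ^ 2) * ((1 - ε) ^ 2 + S * c * q ^ 2) / (2 * S) := by field_simp; ring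
          rw [e1]
          have : 1 + S * c * q ^ 2 / 2 ≤ (1 - ε) ^ 2 + S * c * q ^ 2 := by
            nlinarith [sq_nonneg ε]
          rw [div_le_div_iff_of_pos_right (by positivity)]
          nlinarith [sq_nonneg u]
        calc 4 * (b - A) * c1 * E * (L * u + (1 + L) * W ω)
            ≤ 4 * (b - A) * c1 * E * (k1 * (κ * (Real.exp (c * W ω ^ 2) *
            Real.exp (- (c / 2 * (q * u) ^ 2))))) := by
              have hE0 : 0 < E := Real.exp_pos _
              gcongr
              refine h2.trans ?_
              gcongr
              refine h3.trans ?_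
              gcongr
          _ = (4 * (b - A) * c1 * k1 * κ) * (E * Real.exp (- (c / 2 * (q * u) ^ 2))) *
                Real.exp (c * W ω ^ 2) := by ring
          _ ≤ _ := by gcongr
      · simp only [hf]
        rw [Set.indicator_of_notMem (show ω ∉ {ω | m * u / (2 * S) ≤ (1 + L) * W ω} from hω)]
        exact bot_le
    calc _ ≤ _ := lintegral_mono h1
      _ = ENNReal.ofReal (4 * (b - A) * c1 * k1 * κ *
        Real.exp (-(u ^ 2) * (1 + S * c * q ^ 2 / 2) / (2 * S))) * K := by
          rw [lintegral_const_mul _ (by fun_prop)]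
      _ ≤ _ := by
        conv_lhs => rw [← ENNReal.ofReal_toReal hK.ne]
        rw [← ENNReal.ofReal_mul (by positivity)]
        refine ENNReal.ofReal_le_ofReal ?_
        have : (0:ℝ) ≤ K.toReal := ENNReal.toReal_nonneg
        calc _ = 4 * (b - A) * c1 * k1 * κ * K.toReal *
              Real.exp (-(u ^ 2) * (1 + S * c * q ^ 2 / 2) / (2 * S)) := by ring
          _ ≤ _ := by gcongr; linarith
  have hgfin : ∫⁻ ω, g ω ∂P < ∞ := by
    have h1 : ∀ ω, g ω ≤ ENNReal.ofReal (8 * (b - A) * c1 / (ε * u) *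
        (2 * L ^ 2 * u ^ 2 + 2 * (1 + L) ^ 2 / c)) * ENNReal.ofReal (Real.exp (c * (W ω) ^ 2)) := by
      intro ω
      rw [← ENNReal.ofReal_mul (by positivity)]
      refine ENNReal.ofReal_le_ofReal ?_
      rw [mul_assoc (8 * (b - A) * c1 / (ε * u))]
      gcongr
      have h2 := Real.add_one_le_exp (c * (W ω) ^ 2)
      have h3 : 0 ≤ c * W ω ^ 2 := by positivity
      have h4 : (L * u + (1 + L) * W ω) ^ 2 ≤ 2 * L ^ 2 * u ^ 2 + 2 * (1 + L) ^ 2 * W ω ^ 2 := by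
        nlinarith [sq_nonneg (L * u - (1 + L) * W ω)]
      have h5 : 2 * (1 + L) ^ 2 * W ω ^ 2 = 2 * (1 + L) ^ 2 / c * (c * W ω ^ 2) := by field_simp
      have h6 : 0 ≤ 2 * L ^ 2 * u ^ 2 := by positivity
      have h7 : 0 ≤ 2 * (1 + L) ^ 2 / c := by positivity
      have h8 : (2 * L ^ 2 * u ^ 2) * 1 ≤ (2 * L ^ 2 * u ^ 2) * Real.exp (c * W ω ^ 2) :=
        mul_le_mul_of_nonneg_left (by linarith) h6
      have h9 : 2 * (1 + L) ^ 2 / c * (c * W ω ^ 2) ≤ 2 * (1 + L) ^ 2 / c * Real.exp (c * W ω ^ 2) :=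
        mul_le_mul_of_nonneg_left (by linarith) h7
      rw [add_mul]
      linarith
    refine lt_of_le_of_lt (lintegral_mono h1) ?_
    rw [lintegral_const_mul _ (by fun_prop)]
    exact ENNReal.mul_lt_top ENNReal.ofReal_lt_top hK
  -- Fatou
  set N : ℕ → Ω → ℝ≥0∞ := fun n ω => F.indicator (fun ω => ∑ i ∈ Finset.range (n + 1),
        ({x : ℝ | |x - u| ≤ ((b - A) / (n + 1)) * W ω}.indicator (fun _ => (1 : ℝ≥0∞))
          (X (grid A b n i) ω))) ω with hN
  have hev : ∀ n i : ℕ, MeasurableSet {ω | |X (grid A b n i) ω - u| ≤ ((b - A) / (n + 1)) * W ω} :=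
    fun n i => measurableSet_le (by have := hX (grid A b n i); fun_prop) (by fun_prop)
  have hNeq : ∀ n ω, N n ω = ∑ i ∈ Finset.range (n + 1),
      ({ω | |X (grid A b n i) ω - u| ≤ ((b - A) / (n + 1)) * W ω} ∩ F).indicator (fun _ => (1:ℝ≥0∞)) ω := by
    intro n ω
    simp only [hN]
    by_cases hω : ω ∈ F <;> simp [Set.indicator, hω]
  have hNm : ∀ n, Measurable (N n) := fun n => by
    have : N n = fun ω => ∑ i ∈ Finset.range (n + 1),
      ({ω | |X (grid A b n i) ω - u| ≤ ((b - A) / (n + 1)) * W ω} ∩ F).indicator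
        (fun _ => (1:ℝ≥0∞)) ω := funext (hNeq n)
    rw [this]
    exact Finset.measurable_sum _ fun i _ => measurable_const.indicator ((hev n i).inter hF)
  have hNint : ∀ n : ℕ, (b - A) / (n + 1) ≤ h0 → ∫⁻ ω, N n ω ∂P ≤
      ∫⁻ ω, f ω ∂P + ENNReal.ofReal ((b - A) / (n + 1)) * ∫⁻ ω, g ω ∂P := by
    intro n hn
    set h := (b - A) / ((n:ℝ) + 1) with hh
    have hpos : 0 < h := by positivity
    have hnh : ((n:ℝ) + 1) * h = b - A := by rw [hh]; field_simp
    simp_rw [hNeq]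
    rw [lintegral_finsetSum _ fun i _ => measurable_const.indicator ((hev n i).inter hF)]
    calc _ ≤ ∑ i ∈ Finset.range (n + 1), ∫⁻ ω, {ω | m * u / (2 * S) ≤ (1 + L) * W ω}.indicator (fun ω => ENNReal.ofReal
        (2 * (2 * h * (L * u + (1 + L) * W ω)) * c1 *
        (E + (2 * h * (L * u + (1 + L) * W ω)) / (ε * u)))) ω ∂P := by
          refine Finset.sum_le_sum fun i hi => ?_
          rw [lintegral_indicator ((hev n i).inter hF), setLIntegral_one]
          exact hkey u hu ε hε0 hε1 h hpos hn _ (grid_mem hAb n i (Finset.mem_range.1 hi))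
      _ = ∫⁻ ω, ENNReal.ofReal (n + 1) * {ω | m * u / (2 * S) ≤ (1 + L) * W ω}.indicator (fun ω => ENNReal.ofReal
        (2 * (2 * h * (L * u + (1 + L) * W ω)) * c1 *
        (E + (2 * h * (L * u + (1 + L) * W ω)) / (ε * u)))) ω ∂P := by
          rw [lintegral_const_mul _ (Measurable.indicator (by fun_prop) hSm)]
          rw [Finset.sum_const, nsmul_eq_mul, Finset.card_range]
          congr 1
          rw [ENNReal.ofReal_add (by positivity) zero_le_one]; simp
      _ ≤ ∫⁻ ω, (f ω + ENNReal.ofReal h * g ω) ∂P := by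
          refine lintegral_mono fun ω => ?_
          by_cases hω : m * u / (2 * S) ≤ (1 + L) * W ω
          · have hω' : ω ∈ {ω | m * u / (2 * S) ≤ (1 + L) * W ω} := hω
            have hQ : 0 ≤ (1 + L) * W ω := le_trans (by positivity) hω
            have hE0 : 0 < E := Real.exp_pos _
            simp only [hf, hg]
            rw [Set.indicator_of_mem hω', Set.indicator_of_mem hω',
              ← ENNReal.ofReal_mul (by positivity), ← ENNReal.ofReal_mul (by positivity),
              ← ENNReal.ofReal_add (by positivity) (by positivity)]
            refine ENNReal.ofReal_le_ofReal (le_of_eq ?_)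
            rw [← hnh]; field_simp; ring
          · have hω' : ω ∉ {ω | m * u / (2 * S) ≤ (1 + L) * W ω} := hω
            rw [Set.indicator_of_notMem hω']; simp
      _ = _ := by
          rw [lintegral_add_left hfm, lintegral_const_mul _ hgm]
  refine le_trans ?_ hfbound
  calc _ ≤ ∫⁻ ω, Filter.liminf (fun n => N n ω) Filter.atTop ∂P := by
        refine lintegral_mono_ae ?_
        filter_upwards [hLip] with ω hω
        by_cases hωF : ω ∈ F
        · rw [Set.indicator_of_mem hωF]
          refine (encard_le_liminf (u := u) hAb (fun t => X t ω) hω).trans (le_of_eq ?_)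
          simp only [hN, Set.indicator_of_mem hωF]
        · rw [Set.indicator_of_notMem hωF]; exact bot_le
    _ ≤ Filter.liminf (fun n => ∫⁻ ω, N n ω ∂P) Filter.atTop := lintegral_liminf_le hNm
    _ ≤ Filter.liminf (fun n : ℕ => ∫⁻ ω, f ω ∂P + ENNReal.ofReal ((b - A) / (n + 1)) * ∫⁻ ω, g ω ∂P)
          Filter.atTop := by
        refine Filter.liminf_le_liminf ?_ (by isBoundedDefault) (by isBoundedDefault)
        obtain ⟨n0, hn0⟩ := exists_nat_gt ((b - A) / h0)
        filter_upwards [Filter.eventually_ge_atTop n0] with n hn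
        refine hNint n ?_
        rw [div_lt_iff₀ hh0] at hn0
        rw [div_le_iff₀ (by positivity)]
        have : (n0 : ℝ) ≤ n := by exact_mod_cast hn
        nlinarith
    _ = ∫⁻ ω, f ω ∂P := by
        refine Filter.Tendsto.liminf_eq ?_
        have h1 : Filter.Tendsto (fun n : ℕ => (b - A) / ((n:ℝ) + 1)) Filter.atTop (nhds 0) := by
          have := tendsto_one_div_add_atTop_nhds_zero_nat (𝕜 := ℝ)
          have h2 := this.const_mul (b - A)
          simpa [div_eq_mul_inv] using h2
        have h2 := (ENNReal.tendsto_ofReal h1)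
        rw [ENNReal.ofReal_zero] at h2
        have h3 := ENNReal.Tendsto.mul_const h2 (b := ∫⁻ ω, g ω ∂P) (Or.inr hgfin.ne)
        rw [zero_mul] at h3
        have h4 := h3.const_add (∫⁻ ω, f ω ∂P)
        rwa [add_zero] at h4

end GM

end

section
open scoped ENNReal

set_option linter.unusedSectionVars false

namespace GM

variable {Ω : Type*} [MeasurableSpace Ω] {P : Measure Ω} [IsProbabilityMeasure P] {T : Type*}

/-- second divided difference -/
noncomputable def dd (f : ℝ → ℝ) (a b c : ℝ) : ℝ :=
  ((f c - f b) / (c - b) - (f b - f a) / (b - a)) / (c - a)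

lemma antitoneOn_of_hd {f f' : ℝ → ℝ} {a b : ℝ}
    (h1 : ∀ s ∈ Icc a b, HasDerivWithinAt f (f' s) (Icc a b) s)
    (h2 : ∀ s ∈ Icc a b, f' s ≤ 0) : AntitoneOn f (Icc a b) :=
  antitoneOn_of_hasDerivWithinAt_nonpos (convex_Icc a b) (fun s hs => (h1 s hs).continuousWithinAt)
    (fun s hs => (h1 s (interior_subset hs)).mono interior_subset)
    (fun s hs => h2 s (interior_subset hs))

lemma dd_le {φ φ' φ'' : ℝ → ℝ} {a0 b0 m : ℝ}
    (h1 : ∀ s ∈ Icc a0 b0, HasDerivWithinAt φ (φ' s) (Icc a0 b0) s)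
    (h2 : ∀ s ∈ Icc a0 b0, HasDerivWithinAt φ' (φ'' s) (Icc a0 b0) s)
    (h3 : ∀ s ∈ Icc a0 b0, φ'' s ≤ - (2 * m)) {a b c : ℝ} (ha : a0 ≤ a) (hab : a < b) (hbc : b < c)
    (hc : c ≤ b0) : dd φ a b c ≤ - m := by
  have hanti : AntitoneOn (fun s => φ' s + 2 * m * s) (Icc a0 b0) := by
    refine antitoneOn_of_hd (f' := fun s => φ'' s + 2 * m * 1)
      (fun s hs => (h2 s hs).add ((hasDerivWithinAt_id s _).const_mul _)) fun s hs => ?_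
    have := h3 s hs; simp; linarith
  have hψ : ∀ s ∈ Icc a0 b0, HasDerivWithinAt (fun s => φ s + m * s ^ 2) (φ' s + 2 * m * s)
      (Icc a0 b0) s := fun s hs => by
    refine ((h1 s hs).add (((hasDerivWithinAt_id s _).pow 2).const_mul m)).congr_deriv ?_
    simp; ring
  have mvt : ∀ x y, a0 ≤ x → x < y → y ≤ b0 → ∃ z ∈ Ioo x y, φ' z + 2 * m * z =
      ((φ y + m * y ^ 2) - (φ x + m * x ^ 2)) / (y - x) := by
    intro x y hx hxy hy
    have hsub : Icc x y ⊆ Icc a0 b0 := Icc_subset_Icc hx hy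
    obtain ⟨z, hz, hz'⟩ := exists_hasDerivAt_eq_slope (fun s => φ s + m * s ^ 2)
      (fun s => φ' s + 2 * m * s) hxy
      (fun s hs => ((hψ s (hsub hs)).continuousWithinAt).mono hsub)
      (fun s hs => (hψ s (hsub (Ioo_subset_Icc_self hs))).hasDerivAt
        (Icc_mem_nhds (by linarith [hs.1]) (by linarith [hs.2])))
    exact ⟨z, hz, hz'⟩
  obtain ⟨z1, hz1, e1⟩ := mvt a b ha hab (by linarith)
  obtain ⟨z2, hz2, e2⟩ := mvt b c (by linarith) hbc hc
  have hle := hanti (a := z1) (b := z2) ⟨by linarith [hz1.1], by linarith [hz1.2]⟩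
    ⟨by linarith [hz2.1], by linarith [hz2.2]⟩ (by linarith [hz1.2, hz2.1])
  simp only [e1, e2] at hle
  have hba : b - a ≠ 0 := by linarith
  have hcb : c - b ≠ 0 := by linarith
  have e3 : ((φ c + m * c ^ 2) - (φ b + m * b ^ 2)) / (c - b) = (φ c - φ b) / (c - b) + m * (c + b) := by
    field_simp; ring
  have e4 : ((φ b + m * b ^ 2) - (φ a + m * a ^ 2)) / (b - a) = (φ b - φ a) / (b - a) + m * (b + a) := by
    field_simp; ring
  rw [e3, e4] at hle
  unfold dd
  rw [div_le_iff₀ (by linarith)]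
  linarith

lemma dd_abs_le {φ φ' φ'' : ℝ → ℝ} {a0 b0 K : ℝ}
    (h1 : ∀ s ∈ Icc a0 b0, HasDerivWithinAt φ (φ' s) (Icc a0 b0) s)
    (h2 : ∀ s ∈ Icc a0 b0, HasDerivWithinAt φ' (φ'' s) (Icc a0 b0) s)
    (h3 : ∀ s ∈ Icc a0 b0, |φ'' s| ≤ K) {a b c : ℝ} (ha : a0 ≤ a) (hab : a < b) (hbc : b < c)
    (hc : c ≤ b0) : |dd φ a b c| ≤ K := by
  have hK : 0 ≤ K := le_trans (abs_nonneg _) (h3 a ⟨ha, by linarith⟩)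
  have u1 := dd_le (m := -(K/2)) h1 h2 (fun s hs => by have := (abs_le.1 (h3 s hs)).2; linarith) ha hab hbc hc
  have u2 := dd_le (m := -(K/2)) (φ := fun s => - φ s) (fun s hs => (h1 s hs).neg)
    (fun s hs => (h2 s hs).neg)
    (fun s hs => by have := (abs_le.1 (h3 s hs)).1; linarith) ha hab hbc hc
  have e : dd (fun s => - φ s) a b c = - dd φ a b c := by unfold dd; ring
  rw [e] at u2
  rw [abs_le]; constructor <;> linarith

lemma taylor_abs_le {φ φ' φ'' : ℝ → ℝ} {a0 b0 K : ℝ}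
    (h1 : ∀ s ∈ Icc a0 b0, HasDerivWithinAt φ (φ' s) (Icc a0 b0) s)
    (h2 : ∀ s ∈ Icc a0 b0, HasDerivWithinAt φ' (φ'' s) (Icc a0 b0) s)
    (h3 : ∀ s ∈ Icc a0 b0, |φ'' s| ≤ K) {s t : ℝ} (hs : s ∈ Icc a0 b0) (ht : t ∈ Icc a0 b0) :
    |φ s - φ t - φ' t * (s - t)| ≤ K * (s - t) ^ 2 := by
  have hK : 0 ≤ K := le_trans (abs_nonneg _) (h3 s hs)
  have hl : ∀ x ∈ Icc a0 b0, |φ' x - φ' t| ≤ K * |x - t| := fun x hx => by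
    have := (convex_Icc a0 b0).norm_image_sub_le_of_norm_hasDerivWithin_le (f := φ') (f' := φ'')
      h2 h3 ht hx
    simpa using this
  have hsub : uIcc t s ⊆ Icc a0 b0 := by
    rw [uIcc_comm]; exact (ordConnected_Icc).uIcc_subset hs ht
  have := (convex_uIcc t s).norm_image_sub_le_of_norm_hasDerivWithin_le
    (f := fun x => φ x - φ' t * x) (f' := fun x => φ' x - φ' t * 1) (C := K * |s - t|)
    (fun x hx => ((h1 x (hsub hx)).mono hsub).sub ((hasDerivWithinAt_id x _).const_mul _))
    (fun x hx => by
      rw [Real.norm_eq_abs, mul_one]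
      refine (hl x (hsub hx)).trans ?_
      gcongr K * ?_
      have := Set.abs_sub_left_of_mem_uIcc hx
      exact this) left_mem_uIcc right_mem_uIcc
  simp only [Real.norm_eq_abs] at this
  calc _ = |φ s - φ' t * s - (φ t - φ' t * t)| := by congr 1; ring
    _ ≤ _ := this
    _ = _ := by rw [mul_assoc, ← sq, sq_abs]

/-- A `C²` function on a compact interval has the expected derivatives. -/
lemma c2_data {f : ℝ → ℝ} {A B : ℝ} (hAB : A < B) (hf : ContDiffOn ℝ 2 f (Icc A B)) :
    ∃ f'' : ℝ → ℝ, ContinuousOn (derivWithin f (Icc A B)) (Icc A B) ∧ (∃ K, ∀ s ∈ Icc A B, |f'' s| ≤ K) ∧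
      (∀ s ∈ Icc A B, HasDerivWithinAt f (derivWithin f (Icc A B) s) (Icc A B) s) ∧
      (∀ s ∈ Icc A B, HasDerivWithinAt (derivWithin f (Icc A B)) (f'' s) (Icc A B) s) := by
  have hu := uniqueDiffOn_Icc hAB
  have h1 : ContDiffOn ℝ 1 (derivWithin f (Icc A B)) (Icc A B) :=
    hf.derivWithin hu (by norm_num)
  have h2 : ContinuousOn (derivWithin (derivWithin f (Icc A B)) (Icc A B)) (Icc A B) :=
    h1.continuousOn_derivWithin hu (by norm_num)
  refine ⟨derivWithin (derivWithin f (Icc A B)) (Icc A B), h1.continuousOn, ?_, ?_, ?_⟩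
  · obtain ⟨K, hK⟩ := isCompact_Icc.exists_bound_of_continuousOn h2
    exact ⟨K, hK⟩
  · intro s hs
    exact ((hf.differentiableOn (by norm_num)) s hs).hasDerivWithinAt
  · intro s hs
    exact ((h1.differentiableOn (by norm_num)) s hs).hasDerivWithinAt

/-- partial derivative data of the covariance -/
lemma cov_data {r : ℝ → ℝ → ℝ} {A B : ℝ} (hAB : A < B) (hsym : ∀ s t, r s t = r t s)
    (hrC2 : ContDiffOn ℝ 2 (fun q : ℝ × ℝ => r q.1 q.2) (Icc A B ×ˢ Icc A B))
    (hder0 : derivWithin (fun t => r t t) (Icc A B) A = 0) :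
    ∃ g1 g2 : ℝ × ℝ → ℝ, ContinuousOn g2 (Icc A B ×ˢ Icc A B) ∧ g1 (A, A) = 0 ∧
      (∀ t ∈ Icc A B, ∀ s ∈ Icc A B, HasDerivWithinAt (fun s => r s t) (g1 (s, t)) (Icc A B) s) ∧
      (∀ t ∈ Icc A B, ∀ s ∈ Icc A B, HasDerivWithinAt (fun s => g1 (s, t)) (g2 (s, t)) (Icc A B) s) := by
  set Q := Icc A B ×ˢ Icc A B with hQ
  have hu : UniqueDiffOn ℝ Q := (uniqueDiffOn_Icc hAB).prod (uniqueDiffOn_Icc hAB)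
  set R : ℝ × ℝ → ℝ := fun q => r q.1 q.2 with hR
  have hAm : A ∈ Icc A B := ⟨le_rfl, hAB.le⟩
  have hdR : ∀ p ∈ Q, HasFDerivWithinAt R (fderivWithin ℝ R Q p) Q p := fun p hp =>
    ((hrC2.differentiableOn (by norm_num)) p hp).hasFDerivWithinAt
  have hC1 : ContDiffOn ℝ 1 (fderivWithin ℝ R Q) Q := hrC2.fderivWithin hu (by norm_num)
  set g1 : ℝ × ℝ → ℝ := fun p => fderivWithin ℝ R Q p (1, 0) with hg1
  have hg1C : ContDiffOn ℝ 1 g1 Q := hC1.clm_apply contDiffOn_const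
  have hdg : ∀ p ∈ Q, HasFDerivWithinAt g1 (fderivWithin ℝ g1 Q p) Q p := fun p hp =>
    ((hg1C.differentiableOn (by norm_num)) p hp).hasFDerivWithinAt
  have hline : ∀ t s, HasDerivWithinAt (fun s : ℝ => (s, t)) ((1:ℝ), (0:ℝ)) (Icc A B) s := fun t s =>
    (hasDerivWithinAt_id s _).prodMk (hasDerivWithinAt_const s _ t)
  have hline2 : ∀ t s, HasDerivWithinAt (fun s : ℝ => (t, s)) ((0:ℝ), (1:ℝ)) (Icc A B) s := fun t s =>
    (hasDerivWithinAt_const s _ t).prodMk (hasDerivWithinAt_id s _)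
  have hdiag : ∀ s, HasDerivWithinAt (fun s : ℝ => (s, s)) ((1:ℝ), (1:ℝ)) (Icc A B) s := fun s =>
    (hasDerivWithinAt_id s _).prodMk (hasDerivWithinAt_id s _)
  have hpart : ∀ t ∈ Icc A B, ∀ s ∈ Icc A B,
      HasDerivWithinAt (fun s => r s t) (g1 (s, t)) (Icc A B) s := fun t ht s hs =>
    HasFDerivWithinAt.comp_hasDerivWithinAt (f := fun s : ℝ => (s, t)) s (hdR (s, t) ⟨hs, ht⟩)
      (hline t s) (show MapsTo (fun s : ℝ => (s, t)) (Icc A B) Q from fun x hx => ⟨hx, ht⟩)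
  refine ⟨g1, fun p => fderivWithin ℝ g1 Q p (1, 0), ?_, ?_, hpart, ?_⟩
  · exact (hg1C.continuousOn_fderivWithin hu (by norm_num)).clm_apply continuousOn_const
  · have h1 := HasFDerivWithinAt.comp_hasDerivWithinAt (f := fun s : ℝ => (s, s)) A (hdR (A, A) ⟨hAm, hAm⟩)
      (hdiag A) (show MapsTo (fun s : ℝ => (s, s)) (Icc A B) Q from fun x hx => ⟨hx, hx⟩)
    have h2 := HasFDerivWithinAt.comp_hasDerivWithinAt (f := fun s : ℝ => (A, s)) A (hdR (A, A) ⟨hAm, hAm⟩)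
      (hline2 A A) (show MapsTo (fun s : ℝ => (A, s)) (Icc A B) Q from fun x hx => ⟨hAm, hx⟩)
    have hud := uniqueDiffOn_Icc hAB A hAm
    have e1 : fderivWithin ℝ R Q (A, A) (1, 1) = 0 := by
      rw [← hder0]; exact (h1.derivWithin hud).symm
    have h3 : HasDerivWithinAt (R ∘ fun s => (A, s)) (g1 (A, A)) (Icc A B) A := by
      have := hpart A hAm A hAm
      have e : (R ∘ fun s => (A, s)) = fun s => r s A := by
        funext s; simp [hR, hsym A s]
      rwa [e]
    have e2 : fderivWithin ℝ R Q (A, A) (0, 1) = g1 (A, A) := by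
      rw [← h2.derivWithin hud, h3.derivWithin hud]
    have e3 : ((1:ℝ), (1:ℝ)) = (1, 0) + (0, 1) := by simp
    rw [e3, map_add, e2] at e1
    have : fderivWithin ℝ R Q (A, A) (1, 0) = g1 (A, A) := rfl
    linarith
  · intro t ht s hs
    exact HasFDerivWithinAt.comp_hasDerivWithinAt (f := fun s : ℝ => (s, t)) s (hdg (s, t) ⟨hs, ht⟩)
      (hline t s) (show MapsTo (fun s : ℝ => (s, t)) (Icc A B) Q from fun x hx => ⟨hx, ht⟩)

end GM

end

section
open scoped ENNReal

set_option linter.unusedSectionVars false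

namespace GM

variable {Ω : Type*} [MeasurableSpace Ω] {P : Measure Ω} [IsProbabilityMeasure P] {T : Type*}

lemma cov_incr {X : ℝ → Ω → ℝ} {r : ℝ → ℝ → ℝ} {s t : ℝ}
    (hs : MemLp (X s) 2 P) (ht : MemLp (X t) 2 P) (hr : ∀ s t, r s t = ∫ ω, X s ω * X t ω ∂P) :
    ∫⁻ ω, ENNReal.ofReal ((X s ω - X t ω) ^ 2) ∂P = ENNReal.ofReal (r s s + r t t - 2 * r s t) := by
  have i1 : Integrable (fun ω => X s ω * X s ω) P := hs.integrable_mul hs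
  have i2 : Integrable (fun ω => X s ω * X t ω) P := hs.integrable_mul ht
  have i3 : Integrable (fun ω => X t ω * X t ω) P := ht.integrable_mul ht
  have hinteg : Integrable (fun ω => (X s ω - X t ω) ^ 2) P := (hs.sub ht).integrable_sq
  rw [← ofReal_integral_eq_lintegral_ofReal hinteg (Filter.Eventually.of_forall fun ω => sq_nonneg _)]
  congr 1
  rw [hr, hr, hr]
  have e : (fun ω => (X s ω - X t ω) ^ 2) = fun ω => X s ω * X s ω + X t ω * X t ω - 2 * (X s ω * X t ω) := by
    funext ω; ring
  rw [e, integral_sub (f := fun ω => X s ω * X s ω + X t ω * X t ω) (i1.add i3) (i2.const_mul 2),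
    integral_add (f := fun ω => X s ω * X s ω) i1 i3, integral_const_mul]

lemma cov_concave {X : ℝ → Ω → ℝ} (hX : ∀ t, Measurable (X t)) {r : ℝ → ℝ → ℝ} {A B : ℝ} (hAB : A < B)
    (hL2 : ∀ t ∈ Icc A B, MemLp (X t) 2 P)
    (hpaths : ∀ᵐ ω ∂P, ContDiffOn ℝ 2 (fun t => X t ω) (Icc A B))
    (hr : ∀ s t, r s t = ∫ ω, X s ω * X t ω ∂P)
    (hrC2 : ContDiffOn ℝ 2 (fun q : ℝ × ℝ => r q.1 q.2) (Icc A B ×ˢ Icc A B))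
    (hmax : ∀ t ∈ Icc A B, r t t ≤ r A A)
    (hder0 : derivWithin (fun t => r t t) (Icc A B) A = 0)
    (hnondeg : P {ω | derivWithin (fun s => X s ω) (Icc A B) A = 0} < 1) :
    ∃ m > 0, ∃ b1, A < b1 ∧ b1 ≤ B ∧ ∀ t ∈ Icc A b1, ∀ a b c, A ≤ a → a < b → b < c → c ≤ b1 →
      dd (fun s => r s t) a b c ≤ - m := by
  have hsym : ∀ s t, r s t = r t s := fun s t => by rw [hr, hr]; simp_rw [mul_comm]
  obtain ⟨g1, g2, hg2c, hg10, hd1, hd2⟩ := cov_data hAB hsym hrC2 hder0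
  have hAm : A ∈ Icc A B := ⟨le_rfl, hAB.le⟩
  have hnear : ∀ U : Set ℝ, U ∈ nhds (g2 (A, A)) → ∃ d > 0, A + d ≤ B ∧
      ∀ s ∈ Icc A (A + d), ∀ t ∈ Icc A (A + d), g2 (s, t) ∈ U := by
    intro U hU
    have h1 := hg2c (A, A) ⟨hAm, hAm⟩ hU
    rw [Filter.mem_map, Metric.mem_nhdsWithin_iff] at h1
    obtain ⟨ε, hε, h1⟩ := h1
    refine ⟨min (ε / 2) (B - A), lt_min (by linarith) (by linarith),
      by linarith [min_le_right (ε / 2) (B - A)], fun s hs t ht => ?_⟩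
    have m1 := min_le_left (ε / 2) (B - A)
    have m2 := min_le_right (ε / 2) (B - A)
    have : (s, t) ∈ Metric.ball (A, A) ε ∩ Icc A B ×ˢ Icc A B := by
      refine ⟨?_, ⟨hs.1, by linarith [hs.2]⟩, ⟨ht.1, by linarith [ht.2]⟩⟩
      rw [Metric.mem_ball, Prod.dist_eq, max_lt_iff]
      constructor
      · rw [Real.dist_eq, abs_lt]; constructor <;> simp <;> linarith [hs.1, hs.2]
      · rw [Real.dist_eq, abs_lt]; constructor <;> simp <;> linarith [ht.1, ht.2]
    exact h1 this
  have hneg : g2 (A, A) < 0 := by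
    by_contra hge
    push Not at hge
    have hzero : ∀ η > 0, ∫⁻ ω, ENNReal.ofReal ((derivWithin (fun s => X s ω) (Icc A B) A) ^ 2) ∂P
        ≤ ENNReal.ofReal (2 * η) := by
      intro η hη
      obtain ⟨d, hd, hdB, hdU⟩ := hnear (Ioi (-η)) (Ioi_mem_nhds (by linarith))
      have hsub : Icc A (A + d) ⊆ Icc A B := Icc_subset_Icc le_rfl hdB
      have hAd : A ∈ Icc A (A + d) := ⟨le_rfl, by linarith⟩
      have hf1 : ∀ s ∈ Icc A (A + d), - η * (s - A) ≤ g1 (s, A) := by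
        intro s hs
        have := antitoneOn_of_hd (f := fun s => - g1 (s, A) + - η * s) (f' := fun s => - g2 (s, A) + - η * 1)
          (a := A) (b := A + d)
          (fun s hs => (((hd2 A hAm s (hsub hs)).mono hsub).neg).add
            ((hasDerivWithinAt_id s _).const_mul _))
          (fun s hs => by
            have : -η < g2 (s, A) := hdU s hs A hAd
            linarith) hAd hs hs.1
        simp only [hg10] at this
        linarith
      have hf2 : ∀ s ∈ Icc A (A + d), r A A - η * (s - A) ^ 2 ≤ r s A := by
        intro s hs
        have := antitoneOn_of_hd (f := fun s => - r s A + - η * (s - A) ^ 2)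
          (f' := fun s => - g1 (s, A) + - η * (2 * (s - A)))
          (a := A) (b := A + d)
          (fun s hs => (((hd1 A hAm s (hsub hs)).mono hsub).neg).add
            (((((hasDerivWithinAt_id s _).sub_const A).pow 2).const_mul (-η)).congr_deriv
              (by simp)))
          (fun s hs => by
            have := hf1 s hs
            have h2 : 0 ≤ η * (s - A) := mul_nonneg hη.le (by linarith [hs.1])
            linarith) hAd hs hs.1
        simp only at this
        nlinarith
      set h : ℕ → ℝ := fun n => d * (1 / ((n:ℝ) + 1)) with hh
      have hpos : ∀ n, 0 < h n := fun n => by simp only [hh]; positivity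
      have hle : ∀ n, h n ≤ d := fun n => by
        have : 1 / ((n:ℝ) + 1) ≤ 1 := by
          rw [div_le_one (by positivity)]; linarith [Nat.cast_nonneg (α := ℝ) n]
        simp only [hh]; nlinarith
      have hlim : Filter.Tendsto h Filter.atTop (nhds 0) := by
        have := (tendsto_one_div_add_atTop_nhds_zero_nat (𝕜 := ℝ)).const_mul d
        rwa [mul_zero] at this
      have hmem : ∀ n, A + h n ∈ Icc A (A + d) := fun n => ⟨by linarith [hpos n], by linarith [hle n]⟩
      calc _ ≤ ∫⁻ ω, Filter.liminf (fun n => ENNReal.ofReal (((X (A + h n) ω - X A ω) / h n) ^ 2)) Filter.atTop ∂P := by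
            refine lintegral_mono_ae ?_
            filter_upwards [hpaths] with ω hω
            refine le_of_eq (Filter.Tendsto.liminf_eq ?_).symm
            refine ENNReal.tendsto_ofReal (Filter.Tendsto.pow ?_ 2)
            have hd := ((hω.differentiableOn (by norm_num)) A hAm).hasDerivWithinAt
            rw [hasDerivWithinAt_iff_tendsto_slope] at hd
            have ht : Filter.Tendsto (fun n => A + h n) Filter.atTop (nhdsWithin A (Icc A B \ {A})) := by
              rw [tendsto_nhdsWithin_iff]
              refine ⟨by simpa using hlim.const_add A, Filter.Eventually.of_forall fun n => ?_⟩
              exact ⟨hsub (hmem n), by simpa using (hpos n).ne'⟩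
            have := hd.comp ht
            refine this.congr fun n => ?_
            simp [slope_def_field]
        _ ≤ Filter.liminf (fun n => ∫⁻ ω, ENNReal.ofReal (((X (A + h n) ω - X A ω) / h n) ^ 2) ∂P) Filter.atTop := by
            refine lintegral_liminf_le fun n => ?_
            have := hX (A + h n); have := hX A
            fun_prop
        _ ≤ Filter.liminf (fun n : ℕ => ENNReal.ofReal (2 * η)) Filter.atTop := by
            refine Filter.liminf_le_liminf (Filter.Eventually.of_forall fun n => ?_)
              (by isBoundedDefault) (by isBoundedDefault)
            have e : ∀ ω, ENNReal.ofReal (((X (A + h n) ω - X A ω) / h n) ^ 2) =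
                ENNReal.ofReal (1 / h n ^ 2) * ENNReal.ofReal ((X (A + h n) ω - X A ω) ^ 2) := fun ω => by
              rw [← ENNReal.ofReal_mul (by positivity)]; congr 1; ring
            simp_rw [e]
            rw [lintegral_const_mul _ (by have := hX (A + h n); have := hX A; fun_prop),
              cov_incr (hL2 _ (hsub (hmem n))) (hL2 A hAm) hr, ← ENNReal.ofReal_mul (by positivity)]
            refine ENNReal.ofReal_le_ofReal ?_
            have h1 := hf2 _ (hmem n)
            have h2 := hmax _ (hsub (hmem n))
            have h3 := hpos n
            rw [one_div, inv_mul_le_iff₀ (by positivity)]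
            rw [add_sub_cancel_left] at h1
            linarith
        _ = _ := by simp
    have h0 : ∫⁻ ω, ENNReal.ofReal ((derivWithin (fun s => X s ω) (Icc A B) A) ^ 2) ∂P = 0 := by
      refine le_antisymm ?_ bot_le
      refine ENNReal.le_of_forall_pos_le_add fun ε hε _ => ?_
      rw [zero_add]
      refine (hzero (ε / 2) (by positivity)).trans (le_of_eq ?_)
      rw [mul_div_cancel₀ _ (two_ne_zero)]; simp
    -- measurability
    have hae : AEMeasurable (fun ω => derivWithin (fun s => X s ω) (Icc A B) A) P := by
      set h : ℕ → ℝ := fun n => (B - A) * (1 / ((n:ℝ) + 1)) with hh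
      have hba : 0 < B - A := by linarith
      have hpos : ∀ n, 0 < h n := fun n => by simp only [hh]; positivity
      have hle : ∀ n, h n ≤ B - A := fun n => by
        have : 1 / ((n:ℝ) + 1) ≤ 1 := by
          rw [div_le_one (by positivity)]; linarith [Nat.cast_nonneg (α := ℝ) n]
        simp only [hh]; nlinarith
      have hlim : Filter.Tendsto h Filter.atTop (nhds 0) := by
        have := (tendsto_one_div_add_atTop_nhds_zero_nat (𝕜 := ℝ)).const_mul (B - A)
        rwa [mul_zero] at this
      refine aemeasurable_of_tendsto_metrizable_ae Filter.atTop
        (f := fun n ω => (X (A + h n) ω - X A ω) / h n) (fun n => ?_) ?_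
      · have := hX (A + h n); have := hX A
        fun_prop
      · filter_upwards [hpaths] with ω hω
        have hd := ((hω.differentiableOn (by norm_num)) A hAm).hasDerivWithinAt
        rw [hasDerivWithinAt_iff_tendsto_slope] at hd
        have ht : Filter.Tendsto (fun n => A + h n) Filter.atTop (nhdsWithin A (Icc A B \ {A})) := by
          rw [tendsto_nhdsWithin_iff]
          refine ⟨by simpa using hlim.const_add A, Filter.Eventually.of_forall fun n => ?_⟩
          exact ⟨⟨by linarith [hpos n], by linarith [hle n]⟩, by simpa using (hpos n).ne'⟩
        have := hd.comp ht
        refine this.congr fun n => ?_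
        simp [slope_def_field]
    rw [lintegral_eq_zero_iff' (by fun_prop)] at h0
    have : P {ω | derivWithin (fun s => X s ω) (Icc A B) A = 0} = 1 := by
      rw [← measure_univ (μ := P)]
      refine measure_congr ?_
      filter_upwards [h0] with ω hω
      simp only [Pi.zero_apply, ENNReal.ofReal_eq_zero] at hω
      have h2 : derivWithin (fun s => X s ω) (Icc A B) A = 0 := by
        have := le_antisymm hω (sq_nonneg _)
        exact pow_eq_zero_iff (two_ne_zero) |>.1 this
      exact propext ⟨fun _ => trivial, fun _ => h2⟩
    exact absurd this hnondeg.ne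
  obtain ⟨d, hd, hdB, hdU⟩ := hnear (Iio (g2 (A, A) / 2)) (Iio_mem_nhds (by linarith))
  refine ⟨- g2 (A, A) / 4, by linarith, A + d, by linarith, hdB, fun t ht a b c ha hab hbc hc => ?_⟩
  have hsub : Icc A (A + d) ⊆ Icc A B := Icc_subset_Icc le_rfl hdB
  exact dd_le (φ' := fun s => g1 (s, t)) (φ'' := fun s => g2 (s, t))
    (fun s hs => (hd1 t (hsub ht) s (hsub hs)).mono hsub)
    (fun s hs => (hd2 t (hsub ht) s (hsub hs)).mono hsub)
    (fun s hs => by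
      have : g2 (s, t) < g2 (A, A) / 2 := hdU s hs t ht
      linarith) ha hab hbc hc

end GM

end

section
open scoped ENNReal

set_option linter.unusedSectionVars false

namespace GM

variable {Ω : Type*} [MeasurableSpace Ω] {P : Measure Ω} [IsProbabilityMeasure P] {T : Type*}

lemma rat_seq {a b t : ℝ} (hab : a < b) (ht : t ∈ Icc a b) :
    ∃ q : ℕ → ℚ, (∀ n, (q n : ℝ) ∈ Icc a b) ∧ Filter.Tendsto (fun n => (q n : ℝ)) Filter.atTop (nhds t) := by
  have h1 : Icc a b ⊆ closure (Ioo a b ∩ range ((↑) : ℚ → ℝ)) := by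
    rw [← closure_Ioo hab.ne]
    refine closure_minimal ?_ isClosed_closure
    exact Rat.denseRange_cast.open_subset_closure_inter isOpen_Ioo
  obtain ⟨x, hx, hlim⟩ := mem_closure_iff_seq_limit.1 (h1 ht)
  choose hx1 q hq using hx
  refine ⟨q, fun n => ?_, ?_⟩
  · rw [hq]; exact Ioo_subset_Icc_self (hx1 n)
  · simp_rw [hq]; exact hlim

/-- rationals in the interval -/
abbrev RQ (A B : ℝ) := {q : ℚ // (q : ℝ) ∈ Icc A B}

abbrev Idx (A B : ℝ) := RQ A B ⊕ (RQ A B × RQ A B) ⊕ (RQ A B × RQ A B × RQ A B)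

/-- unit mass at a rational point -/
noncomputable def sg {A B : ℝ} (q : RQ A B) : (Icc A B) →₀ ℝ := Finsupp.single ⟨(q.1 : ℝ), q.2⟩ 1

noncomputable def fam (A B : ℝ) : Idx A B → ((Icc A B) →₀ ℝ)
  | .inl q => sg q
  | .inr (.inl (p, q)) => ((p.1 : ℝ) - q.1)⁻¹ • (sg p - sg q)
  | .inr (.inr (a, b, c)) => if a.1 < b.1 ∧ b.1 < c.1 then
      ((c.1 : ℝ) - a.1)⁻¹ • (((c.1 : ℝ) - b.1)⁻¹ • (sg c - sg b) - ((b.1 : ℝ) - a.1)⁻¹ • (sg b - sg a)) else 0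

def ZZ (X : ℝ → Ω → ℝ) (A B : ℝ) : (Icc A B) → Ω → ℝ := fun t => X t

noncomputable def WW (X : ℝ → Ω → ℝ) (A B : ℝ) (ω : Ω) : ℝ := ⨆ k, |hull (ZZ X A B) (fam A B k) ω|

lemma hull_sg (X : ℝ → Ω → ℝ) (A B : ℝ) (q : RQ A B) (ω : Ω) :
    hull (ZZ X A B) (sg q) ω = X q.1 ω := by
  simp [sg, hull_single, ZZ]

lemma fam_inl (X : ℝ → Ω → ℝ) (A B : ℝ) (q : RQ A B) (ω : Ω) :
    hull (ZZ X A B) (fam A B (.inl q)) ω = X q.1 ω := hull_sg X A B q ω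

lemma fam_mid (X : ℝ → Ω → ℝ) (A B : ℝ) (p q : RQ A B) (ω : Ω) :
    hull (ZZ X A B) (fam A B (.inr (.inl (p, q)))) ω = ((p.1 : ℝ) - q.1)⁻¹ * (X p.1 ω - X q.1 ω) := by
  simp only [fam, hull_smul, hull_sub, hull_sg]

lemma fam_inr (X : ℝ → Ω → ℝ) (A B : ℝ) (a b c : RQ A B) (h : a.1 < b.1 ∧ b.1 < c.1) (ω : Ω) :
    hull (ZZ X A B) (fam A B (.inr (.inr (a, b, c)))) ω = dd (fun t => X t ω) a.1 b.1 c.1 := by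
  simp only [fam, if_pos h, hull_smul, hull_sub, hull_sg, dd]
  ring

lemma fam_inr' (X : ℝ → Ω → ℝ) (A B : ℝ) (a b c : RQ A B) (h : ¬ (a.1 < b.1 ∧ b.1 < c.1)) (ω : Ω) :
    hull (ZZ X A B) (fam A B (.inr (.inr (a, b, c)))) ω = 0 := by
  simp only [fam, if_neg h, hull_zero]

lemma fam_bdd (X : ℝ → Ω → ℝ) {A B : ℝ} (hAB : A < B) (ω : Ω)
    (hω : ContDiffOn ℝ 2 (fun t => X t ω) (Icc A B)) :
    BddAbove (range fun k => |hull (ZZ X A B) (fam A B k) ω|) := by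
  obtain ⟨f'', hc, ⟨K, hK⟩, h1, h2⟩ := c2_data hAB hω
  obtain ⟨K0, hK0⟩ := isCompact_Icc.exists_bound_of_continuousOn hω.continuousOn
  obtain ⟨K1, hK1⟩ := isCompact_Icc.exists_bound_of_continuousOn hc
  have hAm : A ∈ Icc A B := ⟨le_rfl, hAB.le⟩
  have p0 : 0 ≤ K := (abs_nonneg _).trans (hK A hAm)
  have p1 : 0 ≤ K0 := (norm_nonneg _).trans (hK0 A hAm)
  have p2 : 0 ≤ K1 := (norm_nonneg _).trans (hK1 A hAm)
  refine ⟨K0 + K1 + K, ?_⟩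
  rintro _ ⟨k, rfl⟩
  rcases k with q | ⟨p, q⟩ | ⟨a, b, c⟩
  · simp only [fam_inl]
    have := hK0 q.1 q.2
    rw [Real.norm_eq_abs] at this
    linarith
  · simp only [fam_mid]
    have := (convex_Icc A B).norm_image_sub_le_of_norm_hasDerivWithin_le h1 hK1 q.2 p.2
    simp only [Real.norm_eq_abs] at this
    rw [abs_mul, abs_inv]
    have : |(p.1 : ℝ) - q.1|⁻¹ * |X p.1 ω - X q.1 ω| ≤ K1 := by
      rcases eq_or_lt_of_le (abs_nonneg ((p.1 : ℝ) - q.1)) with h | h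
      · rw [← h]; simpa using p2
      · rw [inv_mul_le_iff₀ h]; linarith
    linarith
  · by_cases h : a.1 < b.1 ∧ b.1 < c.1
    · simp only [fam_inr _ _ _ _ _ _ h]
      have := dd_abs_le h1 h2 hK a.2.1 (Rat.cast_lt.2 h.1) (Rat.cast_lt.2 h.2) c.2.2
      linarith
    · simp only [fam_inr' _ _ _ _ _ _ h]
      simp; positivity

lemma WW_bounds (X : ℝ → Ω → ℝ) {A B : ℝ} (hAB : A < B) (ω : Ω)
    (hω : ContDiffOn ℝ 2 (fun t => X t ω) (Icc A B)) :
    (∀ t ∈ Icc A B, |X t ω| ≤ WW X A B ω) ∧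
    (∀ s ∈ Icc A B, ∀ t ∈ Icc A B, |X s ω - X t ω| ≤ WW X A B ω * |s - t|) := by
  have hb := fam_bdd X hAB ω hω
  have hle : ∀ k, |hull (ZZ X A B) (fam A B k) ω| ≤ WW X A B ω := fun k => abs_le_iSup hb k
  have hcont := hω.continuousOn
  have hconv : ∀ t ∈ Icc A B, ∀ q : ℕ → ℚ, (∀ n, (q n : ℝ) ∈ Icc A B) →
      Filter.Tendsto (fun n => (q n : ℝ)) Filter.atTop (nhds t) →
      Filter.Tendsto (fun n => X (q n) ω) Filter.atTop (nhds (X t ω)) := by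
    intro t ht q hq hl
    exact (hcont t ht).tendsto.comp (tendsto_nhdsWithin_iff.2 ⟨hl, Filter.Eventually.of_forall hq⟩)
  constructor
  · intro t ht
    obtain ⟨q, hq, hl⟩ := rat_seq hAB ht
    refine le_of_tendsto (hconv t ht q hq hl).abs (Filter.Eventually.of_forall fun n => ?_)
    have := hle (.inl ⟨q n, hq n⟩)
    rwa [fam_inl] at this
  · intro s hs t ht
    obtain ⟨p, hp, hpl⟩ := rat_seq hAB hs
    obtain ⟨q, hq, hql⟩ := rat_seq hAB ht
    refine le_of_tendsto_of_tendsto ((hconv s hs p hp hpl).sub (hconv t ht q hq hql)).abs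
      ((hpl.sub hql).abs.const_mul _) (Filter.Eventually.of_forall fun n => ?_)
    have := hle (.inr (.inl (⟨p n, hp n⟩, ⟨q n, hq n⟩)))
    rw [fam_mid, abs_mul, abs_inv] at this
    rcases eq_or_lt_of_le (abs_nonneg ((p n : ℝ) - q n)) with h | h
    · have h2 : (p n : ℝ) = q n := by rw [eq_comm, abs_eq_zero, sub_eq_zero] at h; exact h
      simp [h2]
    · rw [inv_mul_le_iff₀ h] at this
      simp only
      linarith

/-- the index set of triples in `[A,b]` -/
def JJ (A B b : ℝ) : Set (Idx A B) :=
  {k | ∃ x y z : RQ A B, k = .inr (.inr (x, y, z)) ∧ x.1 < y.1 ∧ y.1 < z.1 ∧ (z.1 : ℝ) ≤ b}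

lemma concave_of_not_F (X : ℝ → Ω → ℝ) {A B b : ℝ} (hAb : A < b) (hbB : b ≤ B) (ω : Ω)
    (hω : ContDiffOn ℝ 2 (fun t => X t ω) (Icc A B))
    (hF : ¬ ∃ k ∈ JJ A B b, 0 < hull (ZZ X A B) (fam A B k) ω) :
    ConcaveOn ℝ (Icc A b) (fun t => X t ω) := by
  push Not at hF
  have hsub : Icc A b ⊆ Icc A B := Icc_subset_Icc le_rfl hbB
  have hcont := hω.continuousOn.mono hsub
  have hconv : ∀ t ∈ Icc A b, ∀ q : ℕ → ℚ, (∀ n, (q n : ℝ) ∈ Icc A b) →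
      Filter.Tendsto (fun n => (q n : ℝ)) Filter.atTop (nhds t) →
      Filter.Tendsto (fun n => X (q n) ω) Filter.atTop (nhds (X t ω)) := by
    intro t ht q hq hl
    exact (hcont t ht).tendsto.comp (tendsto_nhdsWithin_iff.2 ⟨hl, Filter.Eventually.of_forall hq⟩)
  refine concaveOn_of_slope_anti_adjacent (convex_Icc A b) fun {x y z} hx hz hxy hyz => ?_
  have hy : y ∈ Icc A b := ⟨by linarith [hx.1], by linarith [hz.2]⟩
  obtain ⟨p, hp, hpl⟩ := rat_seq hAb hx
  obtain ⟨q, hq, hql⟩ := rat_seq hAb hy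
  obtain ⟨s, hs, hsl⟩ := rat_seq hAb hz
  have cx := hconv x hx p hp hpl
  have cy := hconv y hy q hq hql
  have cz := hconv z hz s hs hsl
  refine le_of_tendsto_of_tendsto ((cz.sub cy).div (hsl.sub hql) (by linarith))
    ((cy.sub cx).div (hql.sub hpl) (by linarith)) ?_
  filter_upwards [hpl.eventually_lt hql hxy, hql.eventually_lt hsl hyz] with n h1 h2
  have h1' : p n < q n := by exact_mod_cast h1
  have h2' : q n < s n := by exact_mod_cast h2
  have := hF (.inr (.inr (⟨p n, hsub (hp n)⟩, ⟨q n, hsub (hq n)⟩, ⟨s n, hsub (hs n)⟩)))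
    ⟨_, _, _, rfl, h1', h2', (hs n).2⟩
  rw [fam_inr _ _ _ _ _ _ ⟨h1', h2'⟩] at this
  unfold dd at this
  have h3 : (0:ℝ) < s n - p n := by linarith
  rw [div_le_iff₀ h3, zero_mul] at this
  simp only [Pi.div_apply]
  linarith

lemma nonempty_Idx {A B : ℝ} (hAB : A < B) : Nonempty (Idx A B) := by
  obtain ⟨q, h1, h2⟩ := exists_rat_btwn hAB
  exact ⟨.inl ⟨q, h1.le, h2.le⟩⟩

end GM

end

section
open scoped ENNReal

set_option linter.unusedSectionVars false

namespace GM

lemma cross_concave {f f' : ℝ → ℝ} {A b B u : ℝ} (hAb : A < b) (hbB : b ≤ B)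
    (hd : ∀ t ∈ Icc A B, HasDerivWithinAt f (f' t) (Icc A B) t)
    (hconc : ConcaveOn ℝ (Icc A b) f) (hA : f A ≠ u) (hb : f b ≠ u)
    (hnt : ∀ t ∈ Icc A b, ¬ (f t = u ∧ f' t = 0)) (M : Set ℝ) (hM : M ⊆ Icc A b)
    (iE iA iB : ℝ) (hE1 : (∃ t ∈ Icc A b, u ≤ f t) → iE = 1) (hE0 : (¬ ∃ t ∈ Icc A b, u ≤ f t) → iE = 0)
    (hA1 : u ≤ f A → iA = 1) (hA0 : ¬ u ≤ f A → iA = 0) (hB : 0 ≤ iB)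
    (hB1 : (∃ t ∈ Icc A b, t ∉ M ∧ u ≤ f t) → iB = 1) :
    |iE - iA - ((Set.ncard {t ∈ M | f t = u ∧ 0 < f' t} : ℕ) : ℝ)| ≤ iB := by
  have hsub : Icc A b ⊆ Icc A B := Icc_subset_Icc le_rfl hbB
  have hd' : ∀ t ∈ Icc A b, HasDerivWithinAt f (f' t) (Icc A b) t := fun t ht =>
    (hd t (hsub ht)).mono hsub
  have hAm : A ∈ Icc A b := ⟨le_rfl, hAb.le⟩
  have hbm : b ∈ Icc A b := ⟨hAb.le, le_rfl⟩
  have hcont : ContinuousOn f (Icc A b) := fun t ht => (hd' t ht).continuousWithinAt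
  -- tangent lines
  have tan1 : ∀ x ∈ Icc A b, ∀ y ∈ Icc A b, x < y → f y ≤ f x + f' x * (y - x) := by
    intro x hx y hy hxy
    have := hconc.slope_le_of_hasDerivWithinAt hx hy hxy (hd' x hx)
    rw [slope_def_field, div_le_iff₀ (by linarith)] at this
    linarith
  have tan2 : ∀ x ∈ Icc A b, ∀ y ∈ Icc A b, x < y → f x ≤ f y - f' y * (y - x) := by
    intro x hx y hy hxy
    have := hconc.le_slope_of_hasDerivWithinAt hx hy hxy (hd' y hy)
    rw [slope_def_field, le_div_iff₀ (by linarith)] at this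
    linarith
  set N := {t ∈ M | f t = u ∧ 0 < f' t} with hN
  have hleft : ∀ t ∈ N, ∀ s ∈ Icc A b, s < t → f s < u := by
    intro t ht s hs hst
    have := tan2 s hs t (hM ht.1) hst
    have h2 : 0 < f' t * (t - s) := mul_pos ht.2.2 (by linarith)
    linarith [ht.2.1]
  have hsubs : N.Subsingleton := by
    intro x hx y hy
    rcases lt_trichotomy x y with h | h | h
    · have := hleft y hy x (hM hx.1) h
      linarith [hx.2.1]
    · exact h
    · have := hleft x hx y (hM hy.1) h
      linarith [hy.2.1]
  by_cases hE : ∃ t ∈ Icc A b, u ≤ f t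
  · rw [hE1 hE]
    by_cases hfA : u ≤ f A
    · rw [hA1 hfA]
      have : N = ∅ := by
        rw [Set.eq_empty_iff_forall_notMem]
        intro t ht
        have htA : A < t := by
          rcases eq_or_lt_of_le (hM ht.1).1 with h | h
          · exact absurd (h ▸ ht.2.1) hA
          · exact h
        have := hleft t ht A hAm htA
        linarith
      rw [this]; simpa using hB
    · rw [hA0 hfA]
      push Not at hfA
      rcases hsubs.eq_empty_or_singleton with h | ⟨x, h⟩
      · rw [h]
        have : iB = 1 := by
          apply hB1
          by_contra hno
          push Not at hno
          obtain ⟨s, hs, hsmax⟩ := isCompact_Icc.exists_isMaxOn ⟨A, hAm⟩ hcont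
          obtain ⟨t0, ht0, hft0⟩ := hE
          have hs1 : u ≤ f s := hft0.trans (hsmax ht0)
          have hs2 : u < f s := by
            refine lt_of_le_of_ne hs1 fun heq => ?_
            have hsA : A < s := lt_of_le_of_ne hs.1 (by rintro rfl; exact hA heq.symm)
            have hsb : s < b := lt_of_le_of_ne hs.2 (by rintro rfl; exact hb heq.symm)
            have hda : HasDerivAt f (f' s) s := (hd' s hs).hasDerivAt (Icc_mem_nhds hsA hsb)
            have hloc : IsLocalMax f s := hsmax.isLocalMax (Icc_mem_nhds hsA hsb)
            exact hnt s hs ⟨heq.symm, hloc.hasDerivAt_eq_zero hda⟩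
          have hivt := intermediate_value_Icc hs.1 (hcont.mono (Icc_subset_Icc le_rfl hs.2))
          obtain ⟨t, ht, hft⟩ := hivt ⟨hfA.le, hs2.le⟩
          have htI : t ∈ Icc A b := ⟨ht.1, ht.2.trans hs.2⟩
          have hts : t < s := lt_of_le_of_ne ht.2 (by rintro rfl; linarith)
          have hpos : 0 < f' t := by
            have := tan1 t htI s hs hts
            by_contra hneg
            push Not at hneg
            have : f' t * (s - t) ≤ 0 := mul_nonpos_of_nonpos_of_nonneg hneg (by linarith)
            linarith
          have htM : t ∈ M := by
            by_contra htM
            have := hno t htI htM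
            linarith
          have : t ∈ N := ⟨htM, hft, hpos⟩
          rw [h] at this
          exact this
        rw [this]; simp
      · rw [h]; simpa using hB
  · rw [hE0 hE]
    have hfA : ¬ u ≤ f A := fun h => hE ⟨A, hAm, h⟩
    rw [hA0 hfA]
    have : N = ∅ := by
      rw [Set.eq_empty_iff_forall_notMem]
      intro t ht
      exact hE ⟨t, hM ht.1, ht.2.1.ge⟩
    rw [this]; simpa using hB

lemma ncard_le_encard_ennreal (s t : Set ℝ) (h : s ⊆ t) :
    ((s.ncard : ℕ) : ℝ≥0∞) ≤ ((t.encard : ℕ∞) : ℝ≥0∞) := by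
  have h1 : ((s.ncard : ℕ) : ℕ∞) ≤ s.encard := by
    rw [Set.ncard]; exact ENat.coe_toNat_le_self _
  have h2 := h1.trans (encard_le_encard h)
  calc ((s.ncard : ℕ) : ℝ≥0∞) = (((s.ncard : ℕ) : ℕ∞) : ℝ≥0∞) := by simp
    _ ≤ _ := ENat.toENNReal_le.2 h2

lemma cross_F {f f' : ℝ → ℝ} {A b u : ℝ} (hAb : A < b)
    (hcont : ContinuousOn f (Icc A b)) (M : Set ℝ) (hM : M ⊆ Icc A b)
    (iE iA : ℝ) (hE1 : (∃ t ∈ Icc A b, u ≤ f t) → iE = 1) (hE0 : (¬ ∃ t ∈ Icc A b, u ≤ f t) → iE = 0)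
    (hA1 : u ≤ f A → iA = 1) (hA0 : ¬ u ≤ f A → iA = 0) :
    ENNReal.ofReal |iE - iA - ((Set.ncard {t ∈ M | f t = u ∧ 0 < f' t} : ℕ) : ℝ)| ≤
      (({t ∈ Icc A b | f t = u}.encard : ℕ∞) : ℝ≥0∞) := by
  have hAm : A ∈ Icc A b := ⟨le_rfl, hAb.le⟩
  set N := {t ∈ M | f t = u ∧ 0 < f' t} with hN
  have hNle := ncard_le_encard_ennreal N {t ∈ Icc A b | f t = u} (fun t ht => ⟨hM ht.1, ht.2.1⟩)
  have hzero : iE - iA = 0 → ENNReal.ofReal |iE - iA - ((Set.ncard N : ℕ) : ℝ)| ≤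
      (({t ∈ Icc A b | f t = u}.encard : ℕ∞) : ℝ≥0∞) := by
    intro h
    rw [h, zero_sub, abs_neg, Nat.abs_cast, ENNReal.ofReal_natCast]
    exact hNle
  by_cases hE : ∃ t ∈ Icc A b, u ≤ f t
  · by_cases hfA : u ≤ f A
    · exact hzero (by rw [hE1 hE, hA1 hfA, sub_self])
    · rw [hE1 hE, hA0 hfA]
      push Not at hfA
      obtain ⟨s, hs, hfs⟩ := hE
      have hivt := intermediate_value_Icc hs.1 (hcont.mono (Icc_subset_Icc le_rfl hs.2))
      obtain ⟨t, ht, hft⟩ := hivt ⟨hfA.le, hfs⟩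
      have h1 : (1:ℝ≥0∞) ≤ (({t ∈ Icc A b | f t = u}.encard : ℕ∞) : ℝ≥0∞) := by
        have := ncard_le_encard_ennreal {t} {t ∈ Icc A b | f t = u}
          (by rintro _ rfl; exact ⟨⟨ht.1, ht.2.trans hs.2⟩, hft⟩)
        simpa using this
      rcases Nat.eq_zero_or_pos N.ncard with h | h
      · rw [h]; simpa using h1
      · refine le_trans ?_ hNle
        rw [← ENNReal.ofReal_natCast]
        refine ENNReal.ofReal_le_ofReal ?_
        have : (1:ℝ) ≤ N.ncard := by exact_mod_cast h
        rw [abs_le]; constructor <;> linarith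
  · have hfA : ¬ u ≤ f A := fun h => hE ⟨A, hAm, h⟩
    exact hzero (by rw [hE0 hE, hA0 hfA, sub_self])

end GM

end

section
open scoped ENNReal

set_option linter.unusedSectionVars false

namespace GM

variable {Ω : Type*} [MeasurableSpace Ω] {P : Measure Ω} [IsProbabilityMeasure P] {T : Type*}

lemma exists_dense_sub (K : Set ℝ) : ∃ D : Set ℝ, D.Countable ∧ D ⊆ K ∧ K ⊆ closure D := by
  obtain ⟨D, hD, hDd⟩ := TopologicalSpace.exists_countable_dense K
  refine ⟨Subtype.val '' D, hD.image _, by rintro _ ⟨x, _, rfl⟩; exact x.2, fun x hx => ?_⟩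
  have h1 : (⟨x, hx⟩ : K) ∈ closure D := hDd _
  rw [closure_subtype] at h1
  exact h1

lemma compact_event {K : Set ℝ} (hK : IsCompact K) (g : ℝ → Ω → ℝ) (hg : ∀ t ∈ K, AEMeasurable (g t) P)
    (hc : ∀ᵐ ω ∂P, ContinuousOn (fun t => g t ω) K) :
    NullMeasurableSet {ω | ∃ t ∈ K, g t ω ≤ 0} P := by
  obtain ⟨D, hDc, hDK, hKD⟩ := exists_dense_sub K
  have hT : NullMeasurableSet (⋂ j : ℕ, ⋃ t ∈ D, {ω | g t ω < 1 / ((j:ℝ) + 1)}) P := by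
    refine NullMeasurableSet.iInter fun j => NullMeasurableSet.biUnion hDc fun t ht => ?_
    exact nullMeasurableSet_lt (hg t (hDK ht)) aemeasurable_const
  refine hT.congr ?_
  filter_upwards [hc] with ω hω
  refine propext ?_
  change (ω ∈ (⋂ j : ℕ, ⋃ t ∈ D, {ω | g t ω < 1 / ((j:ℝ) + 1)})) ↔ ∃ t ∈ K, g t ω ≤ 0
  simp only [mem_iInter, mem_iUnion, Set.mem_ofPred_eq, exists_prop]
  constructor
  · intro h
    have hne : K.Nonempty := by
      obtain ⟨t, ht, _⟩ := h 0
      exact ⟨t, hDK ht⟩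
    obtain ⟨t, ht, hmin⟩ := hK.exists_isMinOn hne hω
    refine ⟨t, ht, ?_⟩
    refine ge_of_tendsto' (tendsto_one_div_add_atTop_nhds_zero_nat (𝕜 := ℝ)) fun j => ?_
    obtain ⟨d, hd, hdj⟩ := h j
    exact (hmin (hDK hd)).trans hdj.le
  · rintro ⟨t, ht, h0⟩ j
    have h1 : Filter.Tendsto (fun t => g t ω) (nhdsWithin t D) (nhds (g t ω)) := (hω t ht).mono hDK
    haveI : (nhdsWithin t D).NeBot := mem_closure_iff_nhdsWithin_neBot.1 (hKD ht)
    have h2 : ∀ᶠ s in nhdsWithin t D, g s ω < 1 / ((j:ℝ) + 1) :=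
      h1.eventually (gt_mem_nhds (lt_of_le_of_lt h0 (by positivity)))
    obtain ⟨s, hs, hsD⟩ := (h2.and self_mem_nhdsWithin).exists
    exact ⟨s, hsD, hs⟩

lemma deriv_aemeas {X : ℝ → Ω → ℝ} (hX : ∀ t, Measurable (X t)) {A B : ℝ} (hAB : A < B)
    (hpaths : ∀ᵐ ω ∂P, ContDiffOn ℝ 2 (fun t => X t ω) (Icc A B)) {t : ℝ} (ht : t ∈ Icc A B) :
    AEMeasurable (fun ω => derivWithin (fun s => X s ω) (Icc A B) t) P := by
  haveI : (nhdsWithin t (Icc A B \ {t})).NeBot :=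
    accPt_principal_iff_nhdsWithin.1 (uniqueDiffWithinAt_iff_accPt.1 (uniqueDiffOn_Icc hAB t ht))
  refine aemeasurable_of_tendsto_metrizable_ae (nhdsWithin t (Icc A B \ {t}))
    (f := fun s ω => slope (fun s => X s ω) t s) (fun s => ?_) ?_
  · have := hX s; have := hX t
    simp only [slope_def_field]
    fun_prop
  · filter_upwards [hpaths] with ω hω
    have hd := ((hω.differentiableOn (by norm_num)) t ht).hasDerivWithinAt
    exact hasDerivWithinAt_iff_tendsto_slope.1 hd

lemma no_hit {X : ℝ → Ω → ℝ} (hX : ∀ t, Measurable (X t)) {S t : ℝ} (hS : 0 < S)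
    (hv : ∃ v : ℝ≥0, S / 2 ≤ v ∧ P.map (X t) = gaussianReal 0 v) (u : ℝ) :
    ∀ᵐ ω ∂P, X t ω ≠ u := by
  obtain ⟨v, hv1, hv2⟩ := hv
  have := gauss_small_ball0 (u := u) (ρ := 0) (E := 1) hS hv1 le_rfl (fun x _ => by
    rw [Real.exp_le_one_iff]; exact div_nonpos_of_nonpos_of_nonneg (by nlinarith [sq_nonneg x]) (by positivity))
  simp only [mul_zero, zero_mul, ENNReal.ofReal_zero] at this
  rw [← hv2, Measure.map_apply (hX t) (measurableSet_le (by fun_prop) (by fun_prop))] at this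
  rw [ae_iff]
  refine le_antisymm ((measure_mono fun ω hω => ?_).trans this) bot_le
  simp only [Set.mem_ofPred_eq, not_not] at hω
  simp [hω]

lemma no_tangency {X : ℝ → Ω → ℝ} (hX : ∀ t, Measurable (X t)) {A B b S : ℝ} (hS : 0 < S) (hAb : A < b)
    (hbB : b ≤ B)
    (hpaths : ∀ᵐ ω ∂P, ContDiffOn ℝ 2 (fun t => X t ω) (Icc A B))
    (hv : ∀ t ∈ Icc A b, ∃ v : ℝ≥0, S / 2 ≤ v ∧ P.map (X t) = gaussianReal 0 v) (u : ℝ) :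
    ∀ᵐ ω ∂P, ∀ t ∈ Icc A b, ¬ (X t ω = u ∧ derivWithin (fun s => X s ω) (Icc A B) t = 0) := by
  have hsub : Icc A b ⊆ Icc A B := Icc_subset_Icc le_rfl hbB
  have hmain : ∀ K : ℕ, P {ω | ∃ t ∈ Icc A b, ∀ s ∈ Icc A b, |X s ω - u| ≤ K * (s - t) ^ 2} = 0 := by
    intro K
    have hb : ∀ n : ℕ, P {ω | ∃ t ∈ Icc A b, ∀ s ∈ Icc A b, |X s ω - u| ≤ K * (s - t) ^ 2} ≤
        ENNReal.ofReal ((2 * K * (b - A) ^ 2 * (1 / √(Real.pi * S))) * (1 / ((n:ℝ) + 1))) := by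
      intro n
      set h : ℝ := (b - A) / (n + 1) with hh
      have hn : (0:ℝ) < n + 1 := by positivity
      have hpos : 0 < h := div_pos (by linarith) hn
      calc P {ω | ∃ t ∈ Icc A b, ∀ s ∈ Icc A b, |X s ω - u| ≤ K * (s - t) ^ 2}
          ≤ P (⋃ i ∈ Finset.range (n + 1), {ω | |X (grid A b n i) ω - u| ≤ K * h ^ 2}) := by
            refine measure_mono ?_
            rintro ω ⟨t, ht, hts⟩
            obtain ⟨i, hi, h1, h2⟩ := exists_grid hAb n ht
            simp only [mem_iUnion, exists_prop, Finset.mem_range]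
            refine ⟨i, hi, (hts _ (grid_mem hAb n i hi)).trans ?_⟩
            refine mul_le_mul_of_nonneg_left ?_ (Nat.cast_nonneg _)
            exact sq_le_sq' (by linarith) (by linarith)
        _ ≤ ∑ i ∈ Finset.range (n + 1), P {ω | |X (grid A b n i) ω - u| ≤ K * h ^ 2} :=
            measure_biUnion_finset_le _ _
        _ ≤ ∑ i ∈ Finset.range (n + 1), ENNReal.ofReal (2 * (K * h ^ 2) * (1 / √(Real.pi * S)) * 1) := by
            refine Finset.sum_le_sum fun i hi => ?_
            obtain ⟨v, hv1, hv2⟩ := hv _ (grid_mem hAb n i (Finset.mem_range.1 hi))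
            refine le_trans (le_of_eq ?_) (gauss_small_ball0 (u := u) (ρ := K * h ^ 2) (E := 1) hS hv1
              (by positivity) (fun x _ => ?_))
            · rw [← hv2, Measure.map_apply (hX _) (measurableSet_le (by fun_prop) (by fun_prop))]
              rfl
            · rw [Real.exp_le_one_iff]
              exact div_nonpos_of_nonpos_of_nonneg (by nlinarith [sq_nonneg x]) (by positivity)
        _ = _ := by
            rw [Finset.sum_const, Finset.card_range, nsmul_eq_mul, ← ENNReal.ofReal_natCast,
              ← ENNReal.ofReal_mul (by positivity)]
            congr 1
            rw [hh]; push_cast; field_simp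
    have hlim : Filter.Tendsto (fun n : ℕ => ENNReal.ofReal
        ((2 * K * (b - A) ^ 2 * (1 / √(Real.pi * S))) * (1 / ((n:ℝ) + 1)))) Filter.atTop (nhds 0) := by
      have := (tendsto_one_div_add_atTop_nhds_zero_nat (𝕜 := ℝ)).const_mul
        (2 * K * (b - A) ^ 2 * (1 / √(Real.pi * S)))
      rw [mul_zero] at this
      have := ENNReal.tendsto_ofReal this
      rwa [ENNReal.ofReal_zero] at this
    exact le_antisymm (ge_of_tendsto' hlim hb) bot_le
  have hall : ∀ᵐ ω ∂P, ∀ K : ℕ, ¬ ∃ t ∈ Icc A b, ∀ s ∈ Icc A b, |X s ω - u| ≤ K * (s - t) ^ 2 := by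
    rw [ae_all_iff]
    intro K
    rw [ae_iff]
    simpa only [not_not] using hmain K
  filter_upwards [hall, hpaths] with ω hω hp t ht hcon
  obtain ⟨f'', _, ⟨K, hK⟩, h1, h2⟩ := c2_data (lt_of_lt_of_le hAb hbB) hp
  obtain ⟨k, hk⟩ := exists_nat_ge K
  refine hω k ⟨t, ht, fun s hs => ?_⟩
  have := taylor_abs_le h1 h2 hK (hsub hs) (hsub ht)
  rw [hcon.1, hcon.2, zero_mul, sub_zero] at this
  exact this.trans (mul_le_mul_of_nonneg_right hk (sq_nonneg _))

end GM

end

section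
open scoped ENNReal

set_option linter.unusedSectionVars false

namespace GM

variable {Ω : Type*} [MeasurableSpace Ω] {P : Measure Ω} [IsProbabilityMeasure P] {T : Type*}

lemma le_encard_iff_rat (S : Set ℝ) (k : ℕ) : (k : ℕ∞) ≤ S.encard ↔
    ∃ (ε : ℚ) (q : Fin k → ℚ), (∀ i j, i ≠ j → 2 * (ε:ℝ) < |(q i : ℝ) - q j|) ∧
      ∀ i, ∃ t ∈ S, |t - q i| ≤ ε := by
  constructor
  · intro h
    obtain ⟨F, hF, hFk⟩ := Set.exists_subset_encard_eq h
    have hfin : F.Finite := Set.finite_of_encard_eq_coe hFk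
    have hcard : hfin.toFinset.card = k := by
      rw [hfin.encard_eq_coe_toFinset_card] at hFk
      exact_mod_cast hFk
    let e := (hfin.toFinset.equivFinOfCardEq hcard).symm
    have hx : ∀ i, (e i : ℝ) ∈ S := fun i => hF (hfin.mem_toFinset.1 (e i).2)
    have hinj : ∀ i j, i ≠ j → 0 < |(e i : ℝ) - e j| := fun i j hij =>
      abs_pos.2 (sub_ne_zero.2 fun h => hij (e.injective (Subtype.ext h)))
    have hev : ∀ᶠ d in nhdsWithin (0:ℝ) (Ioi 0), ∀ i j, i ≠ j → 4 * d < |(e i : ℝ) - e j| := by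
      rw [Filter.eventually_all]; intro i
      rw [Filter.eventually_all]; intro j
      by_cases hij : i = j
      · simp [hij]
      · have : ∀ᶠ d in nhdsWithin (0:ℝ) (Ioi 0), d < |(e i : ℝ) - e j| / 4 :=
          mem_nhdsWithin_of_mem_nhds (gt_mem_nhds (by have := hinj i j hij; positivity))
        filter_upwards [this] with d hd _
        linarith
    obtain ⟨d, hd, hd0⟩ := (hev.and self_mem_nhdsWithin).exists
    obtain ⟨ε, hε0, hεd⟩ := exists_rat_btwn (show (0:ℝ) < d from hd0)
    have hq : ∀ i, ∃ q : ℚ, |(e i : ℝ) - q| ≤ ε := fun i => by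
      obtain ⟨q, hq1, hq2⟩ := exists_rat_btwn (show (e i : ℝ) < e i + ε by linarith)
      exact ⟨q, by rw [abs_le]; constructor <;> linarith⟩
    choose q hq using hq
    refine ⟨ε, q, fun i j hij => ?_, fun i => ⟨e i, hx i, hq i⟩⟩
    have h1 := hd i j hij
    have h2 := hq i
    have h3 := hq j
    rw [abs_sub_comm] at h3
    have h4 : |(e i : ℝ) - e j| ≤ |(e i : ℝ) - q i| + |(q i : ℝ) - q j| + |(q j : ℝ) - e j| := by
      have : (e i : ℝ) - e j = ((e i : ℝ) - q i) + ((q i : ℝ) - q j) + ((q j : ℝ) - e j) := by ring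
      rw [this]
      exact abs_add_three _ _ _
    linarith
  · rintro ⟨ε, q, hsep, hS⟩
    choose t ht htq using hS
    have hinj : Function.Injective t := by
      intro i j hij
      by_contra hne
      have h1 := hsep i j hne
      have h2 := htq i
      have h3 := htq j
      rw [hij, abs_sub_comm] at h2
      have := abs_sub_le (q i : ℝ) (t j) (q j)
      linarith
    calc (k : ℕ∞) = ENat.card (Fin k) := by simp
      _ ≤ (range t).encard := hinj.encard_range
      _ ≤ S.encard := encard_le_encard (by rintro _ ⟨i, rfl⟩; exact ht i)

lemma ncard_aemeas {M : Set ℝ} (hM : IsCompact M) (g : ℝ → Ω → ℝ) (hg : ∀ t ∈ M, AEMeasurable (g t) P)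
    (hc : ∀ᵐ ω ∂P, ContinuousOn (fun t => g t ω) M) :
    AEMeasurable (fun ω => ((Set.ncard {t ∈ M | g t ω ≤ 0} : ℕ) : ℝ)) P := by
  have hE : ∀ k : ℕ, NullMeasurableSet {ω | (k : ℕ∞) ≤ {t ∈ M | g t ω ≤ 0}.encard} P := by
    intro k
    have : {ω | (k : ℕ∞) ≤ {t ∈ M | g t ω ≤ 0}.encard} =
        ⋃ (ε : ℚ), ⋃ (q : Fin k → ℚ), ⋃ (_ : ∀ i j, i ≠ j → 2 * (ε:ℝ) < |(q i : ℝ) - q j|),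
          ⋂ i, {ω | ∃ t ∈ M ∩ {t | |t - q i| ≤ ε}, g t ω ≤ 0} := by
      ext ω
      simp only [Set.mem_ofPred_eq, le_encard_iff_rat, mem_iUnion, mem_iInter, mem_inter_iff, exists_prop]
      constructor
      · rintro ⟨ε, q, h1, h2⟩
        refine ⟨ε, q, h1, fun i => ?_⟩
        obtain ⟨t, ⟨ht1, ht2⟩, ht3⟩ := h2 i
        exact ⟨t, ⟨ht1, ht3⟩, ht2⟩
      · rintro ⟨ε, q, h1, h2⟩
        refine ⟨ε, q, h1, fun i => ?_⟩
        obtain ⟨t, ⟨ht1, ht2⟩, ht3⟩ := h2 i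
        exact ⟨t, ⟨ht1, ht3⟩, ht2⟩
    rw [this]
    refine NullMeasurableSet.iUnion fun ε => NullMeasurableSet.iUnion fun q => NullMeasurableSet.iUnion fun _ =>
      NullMeasurableSet.iInter fun i => ?_
    refine compact_event (hM.inter_right (isClosed_le (by fun_prop) (by fun_prop))) g
      (fun t ht => hg t ht.1) ?_
    filter_upwards [hc] with ω hω
    exact hω.mono inter_subset_left
  have hN : NullMeasurable (fun ω => Set.ncard {t ∈ M | g t ω ≤ 0}) P := by
    have h0 : ∀ n : ℕ, n ≠ 0 → NullMeasurableSet ((fun ω => Set.ncard {t ∈ M | g t ω ≤ 0}) ⁻¹' {n}) P := by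
      intro n hn
      have : ((fun ω => Set.ncard {t ∈ M | g t ω ≤ 0}) ⁻¹' {n}) =
          {ω | (n : ℕ∞) ≤ {t ∈ M | g t ω ≤ 0}.encard} \ {ω | ((n + 1 : ℕ) : ℕ∞) ≤ {t ∈ M | g t ω ≤ 0}.encard} := by
        ext ω
        simp only [mem_preimage, mem_singleton_iff, mem_diff, Set.mem_ofPred_eq, Set.ncard]
        generalize {t ∈ M | g t ω ≤ 0}.encard = e
        induction e using ENat.recTopCoe with
        | top => simp; exact fun h => hn h.symm
        | coe m =>
          simp only [ENat.toNat_coe, Nat.cast_le]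
          omega
      rw [this]
      exact (hE n).diff (hE (n + 1))
    refine @measurable_to_countable' ℕ (NullMeasurableSpace Ω P) _ _ _ _ fun n => ?_
    by_cases hn : n = 0
    · subst hn
      have : ((fun ω => Set.ncard {t ∈ M | g t ω ≤ 0}) ⁻¹' {0}) =
          (⋃ n : ℕ, ((fun ω => Set.ncard {t ∈ M | g t ω ≤ 0}) ⁻¹' {n + 1}))ᶜ := by
        ext ω
        simp only [mem_preimage, mem_singleton_iff, mem_compl_iff, mem_iUnion, not_exists]
        constructor
        · intro h n; omega
        · intro h; by_contra h1
          obtain ⟨m, hm⟩ := Nat.exists_eq_succ_of_ne_zero h1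
          exact h m hm
      have h2 : NullMeasurableSet ((⋃ n : ℕ, ((fun ω => Set.ncard {t ∈ M | g t ω ≤ 0}) ⁻¹' {n + 1}))ᶜ) P :=
        (NullMeasurableSet.iUnion fun n => h0 (n + 1) (Nat.succ_ne_zero n)).compl
      rw [← this] at h2
      exact h2
    · exact h0 n hn
  have hN2 := hN.aemeasurable
  exact (measurable_from_top (f := fun n : ℕ => (n:ℝ))).comp_aemeasurable hN2

lemma N_aemeas {X : ℝ → Ω → ℝ} (hX : ∀ t, Measurable (X t)) {A B b S : ℝ} (hS : 0 < S) (hAb : A < b)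
    (hbB : b ≤ B)
    (hpaths : ∀ᵐ ω ∂P, ContDiffOn ℝ 2 (fun t => X t ω) (Icc A B))
    (hv : ∀ t ∈ Icc A b, ∃ v : ℝ≥0, S / 2 ≤ v ∧ P.map (X t) = gaussianReal 0 v) (u : ℝ)
    {M : Set ℝ} (hMc : IsCompact M) (hM : M ⊆ Icc A b) :
    AEMeasurable (fun ω => ((Set.ncard {t ∈ M | X t ω = u ∧
      0 < derivWithin (fun s => X s ω) (Icc A B) t} : ℕ) : ℝ)) P := by
  have hAB := lt_of_lt_of_le hAb hbB
  have hsub : Icc A b ⊆ Icc A B := Icc_subset_Icc le_rfl hbB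
  have h1 := ncard_aemeas (P := P) hMc
    (fun t ω => max |X t ω - u| (-derivWithin (fun s => X s ω) (Icc A B) t)) (fun t ht => by
      refine AEMeasurable.max ?_ (deriv_aemeas hX hAB hpaths (hsub (hM ht))).neg
      have := hX t
      fun_prop) (by
      filter_upwards [hpaths] with ω hω
      obtain ⟨f'', hc, _, _⟩ := c2_data hAB hω
      have h2 := hω.continuousOn
      have hMs := hM.trans hsub
      exact ((h2.mono hMs).sub continuousOn_const).abs.sup (hc.mono hMs).neg)
  refine h1.congr ?_
  filter_upwards [no_tangency hX hS hAb hbB hpaths hv u] with ω hω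
  congr 2
  ext t
  simp only [Set.mem_ofPred_eq, max_le_iff, abs_nonpos_iff, sub_eq_zero, neg_nonpos]
  refine and_congr_right fun ht => and_congr_right fun h => ?_
  exact ⟨fun h2 => lt_of_le_of_ne h2 fun h3 => hω t (hM ht) ⟨h, h3.symm⟩, le_of_lt⟩

end GM

end

section
open scoped ENNReal

set_option linter.unusedSectionVars false

namespace GM

variable {Ω : Type*} [MeasurableSpace Ω] {P : Measure Ω} [IsProbabilityMeasure P] {T : Type*}

lemma exists_iff_dense {K D : Set ℝ} (hK : IsCompact K) (hDK : D ⊆ K) (hKD : K ⊆ closure D)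
    (g : ℝ → ℝ) (hg : ContinuousOn g K) (u : ℝ) :
    (∃ t ∈ K, u ≤ g t) ↔ ∀ j : ℕ, ∃ t : D, u - 1 / ((j:ℝ) + 1) < g t := by
  constructor
  · rintro ⟨t, ht, h0⟩ j
    have h1 : Filter.Tendsto g (nhdsWithin t D) (nhds (g t)) := (hg t ht).mono hDK
    have : (nhdsWithin t D).NeBot := mem_closure_iff_nhdsWithin_neBot.1 (hKD ht)
    have hj : 0 < 1 / ((j:ℝ) + 1) := by positivity
    have h2 : ∀ᶠ s in nhdsWithin t D, u - 1 / ((j:ℝ) + 1) < g s :=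
      h1.eventually (lt_mem_nhds (by linarith))
    obtain ⟨s, hs, hsD⟩ := (h2.and self_mem_nhdsWithin).exists
    exact ⟨⟨s, hsD⟩, hs⟩
  · intro h
    have hne : K.Nonempty := by
      obtain ⟨t, _⟩ := h 0
      exact ⟨t, hDK t.2⟩
    obtain ⟨t, ht, hmax⟩ := hK.exists_isMaxOn hne hg
    refine ⟨t, ht, ?_⟩
    have hlim := (tendsto_one_div_add_atTop_nhds_zero_nat (𝕜 := ℝ)).const_sub u
    rw [sub_zero] at hlim
    refine le_of_tendsto' hlim fun j => ?_
    obtain ⟨d, hd⟩ := h j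
    exact hd.le.trans (hmax (hDK d.2))

lemma sym_law (Z : T → Ω → ℝ) (hZ : ∀ t, Measurable (Z t))
    (hG : ∀ (n : ℕ) (c : Fin n → ℝ) (t : Fin n → T),
      ∃ v : ℝ≥0, P.map (fun ω => ∑ i, c i * Z (t i) ω) = gaussianReal 0 v) :
    P.map (fun ω t => Z t ω) = P.map (fun ω t => - Z t ω) := by
  have hm : Measurable (fun ω t => Z t ω) := measurable_pi_lambda _ hZ
  have hm' : Measurable (fun ω t => - Z t ω) := measurable_pi_lambda _ fun t => (hZ t).neg
  rw [map_eq_iff_forall_finset_map_restrict_eq (X := Z) (Y := fun t ω => - Z t ω) hm.aemeasurable hm'.aemeasurable]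
  intro I
  have hI : Measurable (fun ω => I.restrict (Z · ω)) := measurable_pi_lambda _ fun i => hZ i
  have hI' : Measurable (fun ω => I.restrict (fun t => - Z t ω)) := measurable_pi_lambda _ fun i => (hZ i).neg
  have : IsProbabilityMeasure (P.map (fun ω => I.restrict (Z · ω))) := Measure.isProbabilityMeasure_map hI.aemeasurable
  have : IsProbabilityMeasure (P.map (fun ω => I.restrict (fun t => - Z t ω))) :=
    Measure.isProbabilityMeasure_map hI'.aemeasurable
  refine Measure.ext_of_charFunDual ?_
  funext L
  rw [charFunDual_eq_charFun_map_one, charFunDual_eq_charFun_map_one]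
  congr 1
  have hneg : P.map (fun ω => I.restrict (fun t => - Z t ω)) =
      (P.map (fun ω => I.restrict (Z · ω))).map (fun x => -x) := by
    rw [Measure.map_map (by fun_prop) hI]
    rfl
  obtain ⟨v, hv⟩ : ∃ v : ℝ≥0, (P.map (fun ω => I.restrict (Z · ω))).map L = gaussianReal 0 v := by
    classical
    let e := I.equivFin
    obtain ⟨v, hv⟩ := hG I.card (fun i => L (Pi.single (e.symm i) 1)) (fun i => (e.symm i).1)
    refine ⟨v, ?_⟩
    rw [← hv, Measure.map_map (by fun_prop) hI]
    congr 1
    funext ω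
    simp only [Function.comp_apply]
    rw [← L.sum_comp_single]
    rw [← e.symm.sum_comp]
    refine Finset.sum_congr rfl fun i _ => ?_
    simp only [ContinuousLinearMap.comp_apply, Finset.restrict, ContinuousLinearMap.single_apply]
    have : (Pi.single (e.symm i) (Z (e.symm i) ω) : I → ℝ)
        = (Z (e.symm i) ω) • Pi.single (e.symm i) (1:ℝ) := by
      ext j; by_cases h : j = e.symm i
      · subst h; simp
      · simp [Pi.single_apply, h]
    rw [this, map_smul, smul_eq_mul, mul_comm]
  rw [hneg, Measure.map_map (g := L) (f := fun x => -x) (by fun_prop) (by fun_prop)]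
  have h2 : (L ∘ fun x => -x) = (fun x : ℝ => -x) ∘ L := by
    funext x; simp
  rw [h2, ← Measure.map_map (by fun_prop) (by fun_prop), hv, gaussianReal_map_neg, neg_zero]

lemma sym_prob {X : ℝ → Ω → ℝ} (hX : ∀ t, Measurable (X t)) {K : Set ℝ} (hK : IsCompact K)
    (hG : ∀ (n : ℕ) (c : Fin n → ℝ) (t : Fin n → K),
      ∃ v : ℝ≥0, P.map (fun ω => ∑ i, c i * X (t i) ω) = gaussianReal 0 v)
    (hc : ∀ᵐ ω ∂P, ContinuousOn (fun t => X t ω) K) (u : ℝ) :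
    P {ω | ∃ t ∈ K, u ≤ X t ω} = P {ω | ∃ t ∈ K, X t ω ≤ -u} := by
  obtain ⟨D, hDc, hDK, hKD⟩ := exists_dense_sub K
  have hl := sym_law (P := P) (T := D) (fun t => X t) (fun t => hX t)
    (fun n c t => hG n c fun i => ⟨t i, hDK (t i).2⟩)
  have : Countable D := hDc.to_subtype
  let G : Set (D → ℝ) := ⋂ j : ℕ, ⋃ t : D, {f | u - 1 / ((j:ℝ) + 1) < f t}
  have hGm : MeasurableSet G := MeasurableSet.iInter fun j => MeasurableSet.iUnion fun t =>
    measurableSet_lt (by fun_prop) (by fun_prop)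
  have hm : Measurable (fun ω (t : D) => X t ω) := measurable_pi_lambda _ fun t => hX t
  have hm' : Measurable (fun ω (t : D) => - X t ω) := measurable_pi_lambda _ fun t => (hX t).neg
  have h1 : P {ω | ∃ t ∈ K, u ≤ X t ω} = P.map (fun ω (t : D) => X t ω) G := by
    rw [Measure.map_apply hm hGm]
    refine measure_congr ?_
    filter_upwards [hc] with ω hω
    refine propext ?_
    refine (exists_iff_dense hK hDK hKD _ hω u).trans ?_
    change _ ↔ (fun t : D => X t ω) ∈ G
    simp [G]
  have h2 : P {ω | ∃ t ∈ K, X t ω ≤ -u} = P.map (fun ω (t : D) => - X t ω) G := by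
    rw [Measure.map_apply hm' hGm]
    refine measure_congr ?_
    filter_upwards [hc] with ω hω
    refine propext ?_
    have h3 : (∃ t ∈ K, X t ω ≤ -u) ↔ ∃ t ∈ K, u ≤ - X t ω := by
      refine exists_congr fun t => and_congr_right fun _ => ?_
      constructor <;> intro h <;> linarith
    refine h3.trans ((exists_iff_dense hK hDK hKD _ hω.neg u).trans ?_)
    change _ ↔ (fun t : D => - X t ω) ∈ G
    simp [G]
  rw [h1, h2, hl]

lemma gauss_tail {Y : Ω → ℝ} (hY : Measurable Y) {v : ℝ≥0} (hv : P.map Y = gaussianReal 0 v) {V : ℝ}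
    (hV : 0 < V) (hvV : v ≤ V) {a : ℝ} (ha : 0 ≤ a) :
    P {ω | a ≤ |Y ω|} ≤ ENNReal.ofReal (2 * Real.exp (-a ^ 2 / (2 * V))) := by
  have key : ∀ Y : Ω → ℝ, Measurable Y → P.map Y = gaussianReal 0 v →
      P {ω | a ≤ Y ω} ≤ ENNReal.ofReal (Real.exp (-a ^ 2 / (2 * V))) := by
    intro Y hY hv
    have hs : HasSubgaussianMGF Y ⟨V, hV.le⟩ P := by
      constructor
      · intro t
        have h1 := integrable_exp_mul_gaussianReal (μ := 0) (v := v) t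
        rw [← hv] at h1
        exact (integrable_map_measure (by fun_prop) hY.aemeasurable).1 h1
      · intro t
        rw [mgf_gaussianReal hv]
        refine Real.exp_le_exp.2 ?_
        simp only [zero_mul, zero_add]
        change (v:ℝ) * t ^ 2 / 2 ≤ V * t ^ 2 / 2
        gcongr
    have h2 := hs.measure_ge_le ha
    rw [Measure.real] at h2
    exact (ENNReal.le_ofReal_iff_toReal_le (measure_ne_top _ _) (Real.exp_nonneg _)).2 h2
  have hneg : P.map (fun ω => - Y ω) = gaussianReal 0 v := by
    have : P.map (fun ω => - Y ω) = (P.map Y).map (fun x => -x) := by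
      rw [Measure.map_map (by fun_prop) hY]; rfl
    rw [this, hv, gaussianReal_map_neg, neg_zero]
  calc P {ω | a ≤ |Y ω|} ≤ P ({ω | a ≤ Y ω} ∪ {ω | a ≤ - Y ω}) := measure_mono fun ω (hω : a ≤ |Y ω|) => by
        rcases le_abs.1 hω with h | h
        · exact Or.inl h
        · exact Or.inr h
    _ ≤ _ := measure_union_le _ _
    _ ≤ _ := add_le_add (key Y hY hv) (key _ hY.neg hneg)
    _ = _ := by rw [← ENNReal.ofReal_add (by positivity) (by positivity)]; congr 1; ring

lemma W_tail {W : Ω → ℝ} (hW : Measurable W) {c : ℝ} (hc : 0 < c)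
    (hK : ∫⁻ ω, ENNReal.ofReal (Real.exp (c * (W ω) ^ 2)) ∂P < ∞) :
    ∃ K > (0:ℝ), ∀ a : ℝ, 0 ≤ a → P {ω | a ≤ W ω} ≤ ENNReal.ofReal (K * Real.exp (-(c * a ^ 2))) := by
  set I := ∫⁻ ω, ENNReal.ofReal (Real.exp (c * (W ω) ^ 2)) ∂P with hI
  refine ⟨I.toReal + 1, by positivity, fun a ha => ?_⟩
  have hE : 0 < Real.exp (c * a ^ 2) := Real.exp_pos _
  calc P {ω | a ≤ W ω} ≤ P {ω | ENNReal.ofReal (Real.exp (c * a ^ 2)) ≤ ENNReal.ofReal (Real.exp (c * (W ω) ^ 2))} := by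
        refine measure_mono fun ω hω => ?_
        refine ENNReal.ofReal_le_ofReal (Real.exp_le_exp.2 ?_)
        have : a ^ 2 ≤ W ω ^ 2 := pow_le_pow_left₀ ha hω 2
        exact mul_le_mul_of_nonneg_left this hc.le
    _ ≤ I / ENNReal.ofReal (Real.exp (c * a ^ 2)) :=
        meas_ge_le_lintegral_div (by fun_prop) (by simpa using hE) ENNReal.ofReal_ne_top
    _ ≤ _ := by
        rw [Real.exp_neg, ← div_eq_mul_inv, ENNReal.ofReal_div_of_pos hE]
        refine ENNReal.div_le_div_right ?_ _
        refine ENNReal.le_ofReal_iff_toReal_le hK.ne (by positivity) |>.2 (by linarith)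

lemma bad1 {X : ℝ → Ω → ℝ} (hX : ∀ t, Measurable (X t)) {A B S δ c : ℝ} (hAB : A < B) (hS : 0 < S) (hδ : 0 < δ)
    (hc : 0 < c) {r : ℝ → ℝ → ℝ}
    (hv : ∀ t ∈ Icc A B, ∃ v : ℝ≥0, (v:ℝ) = r t t ∧ P.map (X t) = gaussianReal 0 v)
    {W : Ω → ℝ} (hW : Measurable W)
    (hLip : ∀ᵐ ω ∂P, ∀ s ∈ Icc A B, ∀ t ∈ Icc A B, |X s ω - X t ω| ≤ W ω * |s - t|)
    (hK : ∫⁻ ω, ENNReal.ofReal (Real.exp (c * (W ω) ^ 2)) ∂P < ∞) :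
    ∃ χ > (0:ℝ), ∃ C > (0:ℝ), ∀ u > 0,
      P {ω | ∃ t ∈ Icc A B, r t t < S / (1 + δ) ∧ u ≤ |X t ω|} ≤
        ENNReal.ofReal (C * Real.exp (-(u ^ 2) * (1 + χ) / (2 * S))) := by
  obtain ⟨K, hK0, hWt⟩ := W_tail hW hc hK
  set ε := δ / (4 * (1 + δ)) with hε
  have hε0 : 0 < ε := by positivity
  have hε1 : ε ≤ 1 / 4 := by
    rw [hε, div_le_iff₀ (by positivity)]; linarith
  have hεδ : 1 + δ / 2 ≤ (1 - ε) ^ 2 * (1 + δ) := by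
    have h1 : ε * (4 * (1 + δ)) = δ := by rw [hε]; field_simp
    nlinarith [mul_nonneg (sq_nonneg ε) (by linarith : (0:ℝ) ≤ 1 + δ)]
  set h0 := √(2 * S * c * ε ^ 2 / (1 + δ / 2)) with hh0
  have hh0p : 0 < h0 := Real.sqrt_pos.2 (by positivity)
  have hh0s : h0 ^ 2 = 2 * S * c * ε ^ 2 / (1 + δ / 2) := Real.sq_sqrt (by positivity)
  obtain ⟨n, hn⟩ := exists_nat_gt ((B - A) / h0)
  have hn1 : (0:ℝ) < n + 1 := by positivity
  set h : ℝ := (B - A) / (n + 1) with hh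
  have hpos : 0 < h := div_pos (by linarith) hn1
  have hhh : h ≤ h0 := by
    rw [div_lt_iff₀ hh0p] at hn
    rw [hh, div_le_iff₀ hn1]; nlinarith
  let Q : ℕ → ℝ → Prop := fun i t => t ∈ Icc A B ∧ r t t < S / (1 + δ) ∧ grid A B n i ≤ t ∧ t ≤ grid A B n i + h
  have hs : ∀ i, ∃ s, (∃ t, Q i t) → Q i s := fun i => by
    by_cases hex : ∃ t, Q i t
    · obtain ⟨t, ht⟩ := hex; exact ⟨t, fun _ => ht⟩
    · exact ⟨0, fun h => absurd h hex⟩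
  choose s hs using hs
  refine ⟨δ / 2, by positivity, K + (n + 1) * 2, by positivity, fun u hu => ?_⟩
  have hexp1 : ENNReal.ofReal (K * Real.exp (-(c * (ε * u / h) ^ 2))) ≤
      ENNReal.ofReal (K * Real.exp (-(u ^ 2) * (1 + δ / 2) / (2 * S))) := by
    refine ENNReal.ofReal_le_ofReal (mul_le_mul_of_nonneg_left (Real.exp_le_exp.2 ?_) hK0.le)
    have h1 : h ^ 2 ≤ 2 * S * c * ε ^ 2 / (1 + δ / 2) := by
      rw [← hh0s]; exact pow_le_pow_left₀ hpos.le hhh 2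
    rw [le_div_iff₀ (by positivity)] at h1
    have h2 : (1 + δ / 2) / (2 * S) ≤ c * ε ^ 2 / h ^ 2 := by
      rw [div_le_div_iff₀ (by positivity) (by positivity)]; linarith
    have h3 := mul_le_mul_of_nonneg_left h2 (sq_nonneg u)
    have e1 : -(c * (ε * u / h) ^ 2) = -(u ^ 2 * (c * ε ^ 2 / h ^ 2)) := by field_simp
    have e2 : -(u ^ 2) * (1 + δ / 2) / (2 * S) = -(u ^ 2 * ((1 + δ / 2) / (2 * S))) := by ring
    rw [e1, e2]; linarith
  have hexp2 : ENNReal.ofReal (2 * Real.exp (-((1 - ε) * u) ^ 2 / (2 * (S / (1 + δ))))) ≤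
      ENNReal.ofReal (2 * Real.exp (-(u ^ 2) * (1 + δ / 2) / (2 * S))) := by
    refine ENNReal.ofReal_le_ofReal (mul_le_mul_of_nonneg_left (Real.exp_le_exp.2 ?_) two_pos.le)
    have e1 : -((1 - ε) * u) ^ 2 / (2 * (S / (1 + δ))) = -(u ^ 2) * ((1 - ε) ^ 2 * (1 + δ)) / (2 * S) := by
      field_simp
    rw [e1]
    refine div_le_div_of_nonneg_right ?_ (by positivity)
    nlinarith [sq_nonneg u]
  calc P {ω | ∃ t ∈ Icc A B, r t t < S / (1 + δ) ∧ u ≤ |X t ω|}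
      ≤ P ({ω | ε * u / h ≤ W ω} ∪ ⋃ i ∈ Finset.range (n + 1), {ω | Q i (s i) ∧ (1 - ε) * u ≤ |X (s i) ω|}) := by
        refine measure_mono_ae ?_
        filter_upwards [hLip] with ω hω
        rintro ⟨t, ht, hrt, hut⟩
        by_cases hw : ε * u / h ≤ W ω
        · exact Or.inl hw
        right
        rw [not_le, lt_div_iff₀ hpos] at hw
        obtain ⟨i, hi, h1, h2⟩ := exists_grid hAB n ht
        have hq := hs i ⟨t, ht, hrt, h1, h2⟩
        simp only [mem_iUnion, Finset.mem_range, exists_prop]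
        refine ⟨i, hi, hq, ?_⟩
        have h3 := hω t ht (s i) hq.1
        have h4 : |t - s i| ≤ h := by
          rw [abs_le]; constructor <;> linarith [hq.2.2.1, hq.2.2.2]
        have h5 : |X t ω| ≤ |X (s i) ω| + |X t ω - X (s i) ω| := by
          have := abs_add_le (X (s i) ω) (X t ω - X (s i) ω)
          rwa [add_sub_cancel] at this
        by_cases hW0 : 0 ≤ W ω
        · have h6 := mul_le_mul_of_nonneg_left h4 hW0
          linarith
        · have h6 : W ω * |t - s i| ≤ 0 := mul_nonpos_of_nonpos_of_nonneg (by linarith) (abs_nonneg _)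
          nlinarith
    _ ≤ P {ω | ε * u / h ≤ W ω} + ∑ i ∈ Finset.range (n + 1), P {ω | Q i (s i) ∧ (1 - ε) * u ≤ |X (s i) ω|} :=
        (measure_union_le _ _).trans (add_le_add le_rfl (measure_biUnion_finset_le _ _))
    _ ≤ ENNReal.ofReal (K * Real.exp (-(u ^ 2) * (1 + δ / 2) / (2 * S))) +
        ∑ i ∈ Finset.range (n + 1), ENNReal.ofReal (2 * Real.exp (-(u ^ 2) * (1 + δ / 2) / (2 * S))) := by
        refine add_le_add ((hWt _ (by positivity)).trans hexp1) (Finset.sum_le_sum fun i hi => ?_)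
        by_cases hq : Q i (s i)
        · obtain ⟨v, hv1, hv2⟩ := hv _ hq.1
          refine le_trans (measure_mono fun ω hω => hω.2) ((gauss_tail (hX (s i)) hv2
            (by positivity : 0 < S / (1 + δ)) (by rw [hv1]; exact hq.2.1.le)
            (mul_nonneg (by linarith) hu.le)).trans hexp2)
        · simp [hq]
    _ = _ := by
        rw [Finset.sum_const, Finset.card_range, nsmul_eq_mul, ← ENNReal.ofReal_natCast,
          ← ENNReal.ofReal_mul (by positivity), ← ENNReal.ofReal_add (by positivity) (by positivity)]
        congr 1; push_cast; ring

lemma bad2 {X : ℝ → Ω → ℝ} {A b S c : ℝ} (hAb : A < b) (hS : 0 < S)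
    (hc : 0 < c) {W : Ω → ℝ} (hW : Measurable W)
    (hLip : ∀ᵐ ω ∂P, ∀ s ∈ Icc A b, ∀ t ∈ Icc A b, |X s ω - X t ω| ≤ W ω * |s - t|)
    (hK : ∫⁻ ω, ENNReal.ofReal (Real.exp (c * (W ω) ^ 2)) ∂P < ∞) (hb : (b - A) ^ 2 ≤ 4 * c * S) :
    ∃ C > (0:ℝ), ∀ u > 0,
      P ({ω | ∃ t ∈ Icc A b, u ≤ X t ω} ∩ {ω | ∃ t ∈ Icc A b, X t ω ≤ -u}) ≤
        ENNReal.ofReal (C * Real.exp (-(u ^ 2) * (1 + 1) / (2 * S))) := by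
  obtain ⟨K, hK0, hWt⟩ := W_tail hW hc hK
  refine ⟨K, hK0, fun u hu => ?_⟩
  have hba : 0 < b - A := by linarith
  refine le_trans (measure_mono_ae ?_) ((hWt (2 * u / (b - A)) (by positivity)).trans
    (ENNReal.ofReal_le_ofReal (mul_le_mul_of_nonneg_left (Real.exp_le_exp.2 ?_) hK0.le)))
  · filter_upwards [hLip] with ω hω
    rintro ⟨⟨t, ht, h1⟩, s, hs, h2⟩
    change 2 * u / (b - A) ≤ W ω
    rw [div_le_iff₀ hba]
    have h3 := hω t ht s hs
    have h4 := le_abs_self (X t ω - X s ω)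
    have h5 : |t - s| ≤ b - A := by
      rw [abs_le]; constructor <;> linarith [ht.1, ht.2, hs.1, hs.2]
    by_cases hW0 : 0 ≤ W ω
    · have h6 := mul_le_mul_of_nonneg_left h5 hW0
      linarith
    · have h6 : W ω * |t - s| ≤ 0 := mul_nonpos_of_nonpos_of_nonneg (by linarith) (abs_nonneg _)
      linarith
  · have h1 : 1 / S ≤ 4 * c / (b - A) ^ 2 := by
      rw [div_le_div_iff₀ hS (by positivity)]; linarith
    have h3 := mul_le_mul_of_nonneg_left h1 (sq_nonneg u)
    have e1 : -(c * (2 * u / (b - A)) ^ 2) = -(u ^ 2 * (4 * c / (b - A) ^ 2)) := by field_simp; ring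
    have e2 : -(u ^ 2) * (1 + 1) / (2 * S) = -(u ^ 2 * (1 / S)) := by field_simp; norm_num
    rw [e1, e2]; linarith

end GM

end

section
open scoped ENNReal

set_option linter.unusedSectionVars false

namespace GM

variable {Ω : Type*} [MeasurableSpace Ω] {P : Measure Ω} [IsProbabilityMeasure P] {T : Type*}

lemma var_eq {Y : Ω → ℝ} (hY : Measurable Y) {v : ℝ≥0} (hv : P.map Y = gaussianReal 0 v) :
    ∫ ω, Y ω ∂P = 0 ∧ ∫ ω, Y ω * Y ω ∂P = v := by
  have h1 : ∫ ω, Y ω ∂P = ∫ x, x ∂(P.map Y) := (integral_map (f := fun x : ℝ => x) hY.aemeasurable (by fun_prop)).symm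
  have h2 : ∫ ω, Y ω * Y ω ∂P = ∫ x, x * x ∂(P.map Y) :=
    (integral_map (f := fun x : ℝ => x * x) hY.aemeasurable (by fun_prop)).symm
  rw [h1, h2, hv]
  refine ⟨integral_id_gaussianReal, ?_⟩
  have h3 := variance_id_gaussianReal (μ := 0) (v := v)
  rw [variance_of_integral_eq_zero (by fun_prop) (by simp)] at h3
  rw [← h3]
  congr 1
  funext x; simp [pow_two]

lemma WW_meas {X : ℝ → Ω → ℝ} (hX : ∀ t, Measurable (X t)) (A B : ℝ) : Measurable (WW X A B) := by
  unfold WW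
  refine Measurable.iSup fun k => ?_
  have := measurable_hull (ZZ X A B) (fun t => hX t) (fam A B k)
  fun_prop

lemma zc_main {X : ℝ → Ω → ℝ} (hX : ∀ t, Measurable (X t)) {A B : ℝ} (hAB : A < B) {r : ℝ → ℝ → ℝ} {S : ℝ} (hS : 0 < S)
    (hG : IsGaussianProcess (ZZ X A B) P) (h0 : ∀ t, ∫ ω, ZZ X A B t ω ∂P = 0)
    (hpaths : ∀ᵐ ω ∂P, ContDiffOn ℝ 2 (fun t => X t ω) (Icc A B))
    (hr : ∀ s t, r s t = ∫ ω, X s ω * X t ω ∂P)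
    (hmax : ∀ t ∈ Icc A B, r t t ≤ S) {m b1 b : ℝ} (hm : 0 < m) (hb1B : b1 ≤ B)
    (hdd : ∀ t ∈ Icc A b1, ∀ a b c, A ≤ a → a < b → b < c → c ≤ b1 → dd (fun s => r s t) a b c ≤ - m)
    (hAb : A < b) (hbb1 : b ≤ b1) (hσ : ∀ t ∈ Icc A b, S / 2 ≤ r t t) {c : ℝ} (hc : 0 < c)
    (hK : ∫⁻ ω, ENNReal.ofReal (Real.exp (c * (WW X A B ω) ^ 2)) ∂P < ∞) :
    ∃ χ > (0:ℝ), ∃ C > (0:ℝ), ∀ u > 0,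
      ∫⁻ ω, {ω | ∃ k ∈ JJ A B b, 0 < hull (ZZ X A B) (fam A B k) ω}.indicator
        (fun ω => (({t ∈ Icc A b | X t ω = u}.encard : ℕ∞) : ℝ≥0∞)) ω ∂P ≤
        ENNReal.ofReal (C * Real.exp (-(u ^ 2) * (1 + χ) / (2 * S))) := by
  have hZ : ∀ t, Measurable (ZZ X A B t) := fun t => hX t
  have hbB : b ≤ B := hbb1.trans hb1B
  have hsub : Icc A b ⊆ Icc A B := Icc_subset_Icc le_rfl hbB
  have hne := nonempty_Idx hAB
  have hWm := WW_meas hX A B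
  have hH := hull_gaussian (ZZ X A B) hG
  have hbdd : ∀ᵐ ω ∂P, BddAbove (range fun k => |hull (ZZ X A B) (fam A B k) ω|) := by
    filter_upwards [hpaths] with ω hω using fam_bdd X hAB ω hω
  have hL2 : ∀ t ∈ Icc A B, MemLp (X t) 2 P := fun t ht => (hG.hasGaussianLaw_eval ⟨t, ht⟩).memLp_two
  -- second moment of W
  have hW2 : Integrable (fun ω => (WW X A B ω) ^ 2) P := by
    have hi : Integrable (fun ω => Real.exp (c * (WW X A B ω) ^ 2)) P := by
      refine ⟨by fun_prop, ?_⟩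
      rw [hasFiniteIntegral_iff_ofReal (Filter.Eventually.of_forall fun ω => (Real.exp_pos _).le)]
      exact hK
    refine (hi.const_mul c⁻¹).mono' (by fun_prop) (Filter.Eventually.of_forall fun ω => ?_)
    rw [Real.norm_of_nonneg (sq_nonneg _), ← div_eq_inv_mul, le_div_iff₀ hc]
    have := Real.add_one_le_exp (c * (WW X A B ω) ^ 2)
    linarith
  set I2 := ∫ ω, (WW X A B ω) ^ 2 ∂P with hI2
  have hI20 : 0 ≤ I2 := integral_nonneg fun ω => sq_nonneg _
  set L := 2 * I2 / S with hL
  have hL0 : 0 ≤ L := by positivity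
  have hx : ∀ t (ht : t ∈ Icc A B) ω, hull (ZZ X A B) (Finsupp.single ⟨t, ht⟩ 1) ω = X t ω := fun t ht ω => by
    rw [hull_single, one_mul]; rfl
  have hFm : MeasurableSet {ω | ∃ k ∈ JJ A B b, 0 < hull (ZZ X A B) (fam A B k) ω} := by
    have : {ω | ∃ k ∈ JJ A B b, 0 < hull (ZZ X A B) (fam A B k) ω} =
        ⋃ k ∈ JJ A B b, {ω | 0 < hull (ZZ X A B) (fam A B k) ω} := by
      ext ω; simp
    rw [this]
    exact MeasurableSet.biUnion (to_countable _) fun k _ =>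
      measurableSet_lt measurable_const (measurable_hull _ hZ _)
  have hden : 0 < L + m / (2 * S) := by positivity
  refine zc_bound X hX (m := m) (L := L) (h0 := 1 / (4 * (L + m / (2 * S)))) hAb hS hm hL0 (by positivity) hc
    (WW X A B) hWm ?_ hK _ hFm ?_
  · filter_upwards [hpaths] with ω hω s hs t ht
    exact (WW_bounds X hAB ω hω).2 s (hsub hs) t (hsub ht)
  · intro u hu ε hε hε1 h hh hh0 t ht
    have htB := hsub ht
    have hrt : ∫ ω, hull (ZZ X A B) (Finsupp.single ⟨t, htB⟩ 1) ω *
        hull (ZZ X A B) (Finsupp.single ⟨t, htB⟩ 1) ω ∂P = r t t := by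
      simp only [hx]; exact (hr t t).symm
    have hk := key_local (ZZ X A B) hZ hG h0 (fam A B) (Finsupp.single ⟨t, htB⟩ 1) (WW X A B) (fun ω => rfl)
      hbdd (by
        filter_upwards [hpaths] with ω hω
        rw [hx]; exact (WW_bounds X hAB ω hω).1 t htB)
      (S := S) (m := m) (L := L) (u := u) (ε := ε) (h := h) hS hm hL0 hu hε hε1 hh (by
        rw [le_div_iff₀ (by positivity)]
        rw [le_div_iff₀ (by positivity)] at hh0
        linarith)
      (by rw [hrt]; exact hσ t ht) (by rw [hrt]; exact hmax t htB) (by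
        intro k
        rw [hrt]
        have h1 : I2 ≤ L * r t t := by
          have := mul_le_mul_of_nonneg_left (hσ t ht) hL0
          have h2 : L * (S / 2) = I2 := by rw [hL]; field_simp
          linarith
        refine le_trans ?_ h1
        rw [← Real.norm_eq_abs]
        refine norm_integral_le_of_norm_le hW2 ?_
        filter_upwards [hpaths, hbdd] with ω hω hbω
        rw [hx, Real.norm_eq_abs, abs_mul, pow_two]
        have h3 := (WW_bounds X hAB ω hω).1 t htB
        have h4 : |hull (ZZ X A B) (fam A B k) ω| ≤ WW X A B ω := abs_le_iSup hbω k
        exact mul_le_mul h4 h3 (abs_nonneg _) ((abs_nonneg _).trans h4))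
      (JJ A B b) (by
        rintro k ⟨x, y, z, rfl, hxy, hyz, hzb⟩
        have hxy' : (x.1 : ℝ) < y.1 := by exact_mod_cast hxy
        have hyz' : (y.1 : ℝ) < z.1 := by exact_mod_cast hyz
        refine le_trans (le_of_eq ?_) (hdd t ⟨ht.1, ht.2.trans hbb1⟩ x.1 y.1 z.1 x.2.1 hxy' hyz' (hzb.trans hbb1))
        simp only [hx, fam_inr X A B x y z ⟨hxy, hyz⟩, dd]
        have hinteg : ∀ s ∈ Icc A B, Integrable (fun ω => X s ω * X t ω) P := fun s hs =>
          (hL2 s hs).integrable_mul (hL2 t htB)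
        have hix := hinteg _ x.2
        have hiy := hinteg _ y.2
        have hiz := hinteg _ z.2
        have e : ∀ ω, ((X z.1 ω - X y.1 ω) / ((z.1:ℝ) - y.1) - (X y.1 ω - X x.1 ω) / ((y.1:ℝ) - x.1)) /
            ((z.1:ℝ) - x.1) * X t ω = ((X z.1 ω * X t ω - X y.1 ω * X t ω) / ((z.1:ℝ) - y.1) -
              (X y.1 ω * X t ω - X x.1 ω * X t ω) / ((y.1:ℝ) - x.1)) / ((z.1:ℝ) - x.1) := fun ω => by ring
        simp only [e]
        have hi1 : Integrable (fun ω => (X z.1 ω * X t ω - X y.1 ω * X t ω) / ((z.1:ℝ) - y.1)) P :=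
          (hiz.sub hiy).div_const _
        have hi2 : Integrable (fun ω => (X y.1 ω * X t ω - X x.1 ω * X t ω) / ((y.1:ℝ) - x.1)) P :=
          (hiy.sub hix).div_const _
        rw [integral_div, integral_sub hi1 hi2, integral_div, integral_div]
        rw [integral_sub hiz hiy, integral_sub hiy hix, hr, hr, hr])
    simp only [hx] at hk
    exact hk

lemma step_up {E A' : Set Ω} (hE : NullMeasurableSet E P) (hA' : MeasurableSet A') {N : Ω → ℝ} (hN : AEMeasurable N P)
    {G : Ω → ℝ≥0∞} {ρ : ℝ} (hρ : 0 ≤ ρ)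
    (hb : ∀ᵐ ω ∂P, ENNReal.ofReal |E.indicator (fun _ => (1:ℝ)) ω - A'.indicator (fun _ => (1:ℝ)) ω - N ω| ≤ G ω)
    (hG : ∫⁻ ω, G ω ∂P ≤ ENNReal.ofReal ρ) :
    |(P E).toReal - (P A').toReal - ∫ ω, N ω ∂P| ≤ ρ := by
  have hEi : Integrable (E.indicator (fun _ => (1:ℝ))) P := (integrable_const 1).indicator₀ hE
  have hAi : Integrable (A'.indicator (fun _ => (1:ℝ))) P := (integrable_const 1).indicator hA'
  have hE1 : ∫ ω, E.indicator (fun _ => (1:ℝ)) ω ∂P = (P E).toReal := by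
    rw [integral_indicator₀ hE]; simp [Measure.real]
  have hA1 : ∫ ω, A'.indicator (fun _ => (1:ℝ)) ω ∂P = (P A').toReal := by
    rw [integral_indicator hA']; simp [Measure.real]
  set D : Ω → ℝ := fun ω => E.indicator (fun _ => (1:ℝ)) ω - A'.indicator (fun _ => (1:ℝ)) ω - N ω with hD
  have hle : ∫⁻ ω, ENNReal.ofReal ‖D ω‖ ∂P ≤ ENNReal.ofReal ρ :=
    (lintegral_mono_ae (by filter_upwards [hb] with ω hω using hω)).trans hG
  have hDi : Integrable D P := by
    refine ⟨(hEi.1.sub hAi.1).sub hN.aestronglyMeasurable, ?_⟩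
    rw [hasFiniteIntegral_iff_norm]
    exact lt_of_le_of_lt hle ENNReal.ofReal_lt_top
  have hNeq : ∀ ω, N ω = E.indicator (fun _ => (1:ℝ)) ω - A'.indicator (fun _ => (1:ℝ)) ω - D ω := fun ω => by
    simp only [hD]; ring
  have hNint : ∫ ω, N ω ∂P = (P E).toReal - (P A').toReal - ∫ ω, D ω ∂P := by
    rw [integral_congr_ae (Filter.Eventually.of_forall hNeq),
      integral_sub (f := fun ω => E.indicator (fun _ => (1:ℝ)) ω - A'.indicator (fun _ => (1:ℝ)) ω) (hEi.sub hAi) hDi,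
      integral_sub hEi hAi, hE1, hA1]
  rw [hNint, sub_sub_cancel, ← Real.norm_eq_abs]
  refine (norm_integral_le_lintegral_norm D).trans ?_
  exact ENNReal.toReal_le_of_le_ofReal hρ hle

lemma two_sided {E1 E2 Q Bd : Set Ω} (hE2 : NullMeasurableSet E2 P) (heq : P E1 = P E2)
    (h1 : E1 ∪ E2 ⊆ Q) (h2 : Q ⊆ (E1 ∪ E2) ∪ Bd) {ρ1 ρ2 : ℝ} (hρ1 : 0 ≤ ρ1) (hρ2 : 0 ≤ ρ2)
    (hB : P Bd ≤ ENNReal.ofReal ρ1) (hI : P (E1 ∩ E2) ≤ ENNReal.ofReal ρ2) :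
    |(P Q).toReal - 2 * (P E1).toReal| ≤ ρ1 + ρ2 := by
  have e1 := measure_union_add_inter₀ E1 hE2
  have e2 := congrArg ENNReal.toReal e1
  rw [ENNReal.toReal_add (measure_ne_top _ _) (measure_ne_top _ _),
    ENNReal.toReal_add (measure_ne_top _ _) (measure_ne_top _ _), ← heq] at e2
  have h3 : (P (E1 ∪ E2)).toReal ≤ (P Q).toReal := ENNReal.toReal_mono (measure_ne_top _ _) (measure_mono h1)
  have h4 : (P Q).toReal ≤ (P (E1 ∪ E2)).toReal + (P Bd).toReal := by
    rw [← ENNReal.toReal_add (measure_ne_top _ _) (measure_ne_top _ _)]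
    exact ENNReal.toReal_mono (by simp) ((measure_mono h2).trans (measure_union_le _ _))
  have h5 := ENNReal.toReal_le_of_le_ofReal hρ1 hB
  have h6 := ENNReal.toReal_le_of_le_ofReal hρ2 hI
  have h7 : 0 ≤ (P (E1 ∩ E2)).toReal := ENNReal.toReal_nonneg
  rw [abs_le]; constructor <;> linarith

end GM

end

open scoped ENNReal in
set_option maxHeartbeats 4000000 in
/-- Centered Gaussian process on `[A,B]`, a.s. `C²` paths, `C²` covariance,
variance maximal at the unique point `t₀ = A` with `(σ²)′(A) = 0` and
`ℙ(∂ₜX(A) = 0) < 1`. Then there are `δ, χ, C, u₀ > 0` such that for `u ≥ u₀`,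
`|ℙ(max_{[A,B]}|X| ≥ u) − 2ℙ(X(A) ≥ u) − 2E[N_u⁺(𝓜(δ))]| ≤ C e^{−u²(1+χ)/(2S)}`,
where `N_u⁺(M)` is the number of up-crossings of the level `u` on `M` and
`𝓜(δ) = {t ∈ [A,B] : σ²(t) ≥ S/(1+δ)}`. -/
theorem statement1
    {Ω : Type*} [MeasurableSpace Ω] (P : Measure Ω) [IsProbabilityMeasure P]
    (A B : ℝ) (hAB : A < B)
    (X : ℝ → Ω → ℝ)
    (hjm : Measurable (Function.uncurry X))
    (hGauss : ∀ (n : ℕ) (c : Fin n → ℝ) (t : Fin n → ℝ),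
      (∀ i, t i ∈ Set.Icc A B) →
      ∃ v : ℝ≥0, Measure.map (fun ω => ∑ i, c i * X (t i) ω) P = gaussianReal 0 v)
    (hpaths : ∀ᵐ ω ∂P, ContDiffOn ℝ 2 (fun t => X t ω) (Set.Icc A B))
    (r : ℝ → ℝ → ℝ)
    (hr : ∀ s t, r s t = ∫ ω, X s ω * X t ω ∂P)
    (hrC2 : ContDiffOn ℝ 2 (fun q : ℝ × ℝ => r q.1 q.2) (Set.Icc A B ×ˢ Set.Icc A B))
    (hmax : ∀ t ∈ Set.Icc A B, r t t ≤ r A A)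
    (huniq : ∀ t ∈ Set.Icc A B, r t t = r A A → t = A)
    (hder0 : derivWithin (fun t => r t t) (Set.Icc A B) A = 0)
    (hnondeg : P {ω | derivWithin (fun s => X s ω) (Set.Icc A B) A = 0} < 1) :
    ∃ δ > (0:ℝ), ∃ χ > (0:ℝ), ∃ C > (0:ℝ), ∃ u₀ > (0:ℝ), ∀ u ≥ u₀,
      |(P {ω | ∃ t ∈ Set.Icc A B, u ≤ |X t ω|}).toReal
          - 2 * (P {ω | u ≤ X A ω}).toReal
          - 2 * ∫ ω, ((Set.ncard {t ∈ {t ∈ Set.Icc A B | r A A / (1 + δ) ≤ r t t} |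
              X t ω = u ∧ 0 < derivWithin (fun s => X s ω) (Set.Icc A B) t} : ℕ) : ℝ) ∂P|
        ≤ C * Real.exp (-(u ^ 2) * (1 + χ) / (2 * r A A)) := by
  classical
  have hX : ∀ t, Measurable (X t) := fun t => hjm.comp (measurable_const.prodMk measurable_id)
  have hAm : A ∈ Icc A B := ⟨le_rfl, hAB.le⟩
  have hBm : B ∈ Icc A B := ⟨hAB.le, le_rfl⟩
  have hG0 : ∀ (n : ℕ) (c : Fin n → ℝ) (t : Fin n → Icc A B),
      ∃ v : ℝ≥0, P.map (fun ω => ∑ i, c i * GM.ZZ X A B (t i) ω) = gaussianReal 0 v := fun n c t =>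
    hGauss n c (fun i => t i) fun i => (t i).2
  have hZ : ∀ t, Measurable (GM.ZZ X A B t) := fun t => hX t
  have hG : IsGaussianProcess (GM.ZZ X A B) P := GM.gaussianProcess_of_lin _ hZ hG0
  have hv : ∀ t ∈ Icc A B, ∃ v : ℝ≥0, (v:ℝ) = r t t ∧ P.map (X t) = gaussianReal 0 v := by
    intro t ht
    obtain ⟨v, hv⟩ := hGauss 1 (fun _ => 1) (fun _ => t) (fun _ => ht)
    simp only [Finset.univ_unique, Finset.sum_const, Finset.card_singleton, one_smul, one_mul] at hv
    exact ⟨v, by rw [hr, (GM.var_eq (hX t) hv).2], hv⟩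
  have h0 : ∀ t, ∫ ω, GM.ZZ X A B t ω ∂P = 0 := fun t => by
    obtain ⟨v, _, hv⟩ := hv t t.2
    exact (GM.var_eq (hX t) hv).1
  have hL2 : ∀ t ∈ Icc A B, MemLp (X t) 2 P := fun t ht => (hG.hasGaussianLaw_eval ⟨t, ht⟩).memLp_two
  have hrnn : ∀ t ∈ Icc A B, 0 ≤ r t t := fun t ht => by
    obtain ⟨v, hv, _⟩ := hv t ht
    rw [← hv]; exact v.2
  set S := r A A with hSdef
  have hS : 0 < S := by
    rcases eq_or_lt_of_le (hrnn A hAm) with h | h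
    · exfalso
      have h1 := huniq B hBm (le_antisymm (hmax B hBm) (by rw [hSdef, ← h]; exact hrnn B hBm))
      linarith
    · exact h
  have hne := GM.nonempty_Idx hAB
  have hbdd : ∀ᵐ ω ∂P, BddAbove (range fun k => |GM.hull (GM.ZZ X A B) (GM.fam A B k) ω|) := by
    filter_upwards [hpaths] with ω hω using GM.fam_bdd X hAB ω hω
  have hWm := GM.WW_meas hX A B
  obtain ⟨c, hc, hK⟩ := GM.fernique_family (P := P) (fun k => GM.hull (GM.ZZ X A B) (GM.fam A B k))
    (fun k => GM.measurable_hull _ hZ _) ((GM.hull_gaussian _ hG).comp_right (GM.fam A B))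
    (fun k => GM.hull_mean _ hG h0 _) hbdd
  change ∫⁻ ω, ENNReal.ofReal (Real.exp (c * (GM.WW X A B ω) ^ 2)) ∂P < ∞ at hK
  have hWb : ∀ᵐ ω ∂P, ∀ s ∈ Icc A B, ∀ t ∈ Icc A B, |X s ω - X t ω| ≤ GM.WW X A B ω * |s - t| := by
    filter_upwards [hpaths] with ω hω using (GM.WW_bounds X hAB ω hω).2
  obtain ⟨m, hm, b1, hAb1, hb1B, hdd⟩ := GM.cov_concave hX hAB hL2 hpaths hr hrC2 hmax hder0 hnondeg
  have hσc : ContinuousOn (fun t => r t t) (Icc A B) :=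
    hrC2.continuousOn.comp (f := fun t : ℝ => (t, t)) (by fun_prop) (fun t ht => ⟨ht, ht⟩)
  -- choice of `b`
  obtain ⟨d, hd, hdS⟩ := Metric.continuousWithinAt_iff.1 (hσc A hAm) (S / 2) (by positivity)
  have hsq : 0 < √(4 * c * S) := Real.sqrt_pos.2 (by positivity)
  set l := min (b1 - A) (min (d / 2) √(4 * c * S)) with hl
  have hl0 : 0 < l := lt_min (by linarith) (lt_min (by positivity) hsq)
  have hl1 : l ≤ b1 - A := min_le_left _ _
  have hl2 : l ≤ d / 2 := (min_le_right _ _).trans (min_le_left _ _)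
  have hl3 : l ≤ √(4 * c * S) := (min_le_right _ _).trans (min_le_right _ _)
  obtain ⟨b, hb⟩ : ∃ b, b = A + l := ⟨_, rfl⟩
  have hAb : A < b := by linarith
  have hbb1 : b ≤ b1 := by linarith
  have hbB : b ≤ B := hbb1.trans hb1B
  have hsub : Icc A b ⊆ Icc A B := Icc_subset_Icc le_rfl hbB
  have hσ : ∀ t ∈ Icc A b, S / 2 ≤ r t t := by
    intro t ht
    have := hdS (hsub ht) (by rw [Real.dist_eq, abs_of_nonneg (by linarith [ht.1])]; linarith [ht.2])
    rw [Real.dist_eq, abs_lt] at this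
    linarith [this.1]
  have hb2 : (b - A) ^ 2 ≤ 4 * c * S := by
    have h1 : b - A = l := by linarith
    rw [h1, ← Real.sq_sqrt (by positivity : 0 ≤ 4 * c * S)]
    exact pow_le_pow_left₀ hl0.le hl3 2
  have hvb : ∀ t ∈ Icc A b, ∃ v : ℝ≥0, S / 2 ≤ v ∧ P.map (X t) = gaussianReal 0 v := fun t ht => by
    obtain ⟨v, h1, h2⟩ := hv t (hsub ht)
    exact ⟨v, by rw [h1]; exact hσ t ht, h2⟩
  -- choice of `δ`
  have hbsub : Icc b B ⊆ Icc A B := Icc_subset_Icc hAb.le le_rfl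
  obtain ⟨ts, hts, htsmax⟩ := (isCompact_Icc (a := b) (b := B)).exists_isMaxOn ⟨B, hbB, le_rfl⟩ (hσc.mono hbsub)
  have hvs : r ts ts < S := by
    refine lt_of_le_of_ne (hmax ts (hbsub hts)) fun h => ?_
    have := huniq ts (hbsub hts) h
    linarith [hts.1]
  have hvs0 := hrnn ts (hbsub hts)
  set δ := (S - r ts ts) / (2 * S) with hδ
  have hδ0 : 0 < δ := div_pos (by linarith) (by positivity)
  have hδS : r ts ts < S / (1 + δ) := by
    rw [lt_div_iff₀ (by positivity)]
    have h1 : δ * (2 * S) = S - r ts ts := by rw [hδ]; field_simp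
    nlinarith
  set M := {t ∈ Icc A B | S / (1 + δ) ≤ r t t} with hM
  have hMb : M ⊆ Icc A b := by
    intro t ht
    refine ⟨ht.1.1, ?_⟩
    by_contra hcon
    have h1 : r t t ≤ r ts ts := htsmax ⟨(not_le.1 hcon).le, ht.1.2⟩
    linarith [ht.2]
  have hMc : IsCompact M :=
    isCompact_Icc.of_isClosed_subset (hσc.preimage_isClosed_of_isClosed isClosed_Icc isClosed_Ici) fun t ht => ht.1
  -- the three error bounds
  obtain ⟨χ1, hχ1, C1, hC1, hB1⟩ := GM.bad1 hX hAB hS hδ0 hc hv hWm hWb hK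
  obtain ⟨C2, hC2, hB2⟩ := GM.bad2 (X := X) hAb hS hc hWm
    (by filter_upwards [hWb] with ω hω s hs t ht using hω s (hsub hs) t (hsub ht)) hK hb2
  obtain ⟨χ3, hχ3, C3, hC3, hB3⟩ := GM.zc_main hX hAB hS hG h0 hpaths hr hmax hm hb1B hdd hAb hbb1 hσ hc hK
  refine ⟨δ, hδ0, min χ1 (min 1 χ3), lt_min hχ1 (lt_min one_pos hχ3), 3 * C1 + C2 + 2 * C3, by positivity, 1,
    one_pos, fun u hu1 => ?_⟩
  have hu : 0 < u := by linarith
  set χ := min χ1 (min 1 χ3) with hχ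
  have hexp : ∀ χ' ≥ χ, Real.exp (-(u ^ 2) * (1 + χ') / (2 * S)) ≤ Real.exp (-(u ^ 2) * (1 + χ) / (2 * S)) := by
    intro χ' h
    refine Real.exp_le_exp.2 (div_le_div_of_nonneg_right ?_ (by positivity))
    nlinarith [sq_nonneg u]
  have hx1 := hexp χ1 (min_le_left _ _)
  have hx2 := hexp 1 ((min_le_right _ _).trans (min_le_left _ _))
  have hx3 := hexp χ3 ((min_le_right _ _).trans (min_le_right _ _))
  have hB1u := hB1 u hu
  have hB2u := hB2 u hu
  have hB3u := hB3 u hu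
  set e1 := Real.exp (-(u ^ 2) * (1 + χ1) / (2 * S)) with he1
  set e2 := Real.exp (-(u ^ 2) * (1 + 1) / (2 * S)) with he2
  set e3 := Real.exp (-(u ^ 2) * (1 + χ3) / (2 * S)) with he3
  have he10 : 0 < e1 := Real.exp_pos _
  have he20 : 0 < e2 := Real.exp_pos _
  have he30 : 0 < e3 := Real.exp_pos _
  set E1 := {ω | ∃ t ∈ Icc A b, u ≤ X t ω} with hE1
  set E2 := {ω | ∃ t ∈ Icc A b, X t ω ≤ -u} with hE2
  set Bd := {ω | ∃ t ∈ Icc A B, r t t < S / (1 + δ) ∧ u ≤ |X t ω|} with hBd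
  have hcont : ∀ᵐ ω ∂P, ContinuousOn (fun t => X t ω) (Icc A b) := by
    filter_upwards [hpaths] with ω hω using hω.continuousOn.mono hsub
  have hE1m : NullMeasurableSet E1 P := by
    have := GM.compact_event (P := P) (isCompact_Icc (a := A) (b := b)) (fun t ω => u - X t ω)
      (fun t _ => ((hX t).const_sub u).aemeasurable)
      (by filter_upwards [hcont] with ω hω using continuousOn_const.sub hω)
    simpa only [sub_nonpos] using this
  have hE2m : NullMeasurableSet E2 P := by
    have := GM.compact_event (P := P) (isCompact_Icc (a := A) (b := b)) (fun t ω => X t ω - (-u))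
      (fun t _ => ((hX t).sub_const (-u)).aemeasurable)
      (by filter_upwards [hcont] with ω hω using hω.sub continuousOn_const)
    simpa only [sub_nonpos] using this
  have hsym : P E1 = P E2 := GM.sym_prob hX isCompact_Icc
    (fun n c t => hGauss n c (fun i => t i) fun i => hsub (t i).2) hcont u
  have hstep2 := GM.two_sided (P := P) (E1 := E1) (E2 := E2) (Q := {ω | ∃ t ∈ Icc A B, u ≤ |X t ω|}) (Bd := Bd)
    (ρ1 := C1 * e1) (ρ2 := C2 * e2) hE2m hsym (by
      rintro ω (⟨t, ht, h⟩ | ⟨t, ht, h⟩)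
      · exact ⟨t, hsub ht, h.trans (le_abs_self _)⟩
      · exact ⟨t, hsub ht, le_trans (by linarith) (neg_le_abs _)⟩) (by
      rintro ω ⟨t, ht, h⟩
      by_cases htM : t ∈ M
      · left
        rcases le_abs.1 h with h | h
        · exact Or.inl ⟨t, hMb htM, h⟩
        · exact Or.inr ⟨t, hMb htM, by linarith⟩
      · right
        exact ⟨t, ht, lt_of_not_ge fun h2 => htM ⟨ht, h2⟩, h⟩) (by positivity) (by positivity) hB1u hB2u
  have hNm := GM.N_aemeas hX hS hAb hbB hpaths hvb u hMc hMb
  have hstep1 := GM.step_up (P := P) (E := E1) (A' := {ω | u ≤ X A ω}) (ρ := C1 * e1 + C3 * e3)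
    (G := fun ω => (toMeasurable P Bd).indicator (fun _ => (1:ℝ≥0∞)) ω +
      {ω | ∃ k ∈ GM.JJ A B b, 0 < GM.hull (GM.ZZ X A B) (GM.fam A B k) ω}.indicator
        (fun ω => (({t ∈ Icc A b | X t ω = u}.encard : ℕ∞) : ℝ≥0∞)) ω)
    hE1m (measurableSet_le measurable_const (hX A)) hNm (by positivity) (by
      filter_upwards [hpaths, GM.no_tangency hX hS hAb hbB hpaths hvb u,
        GM.no_hit hX hS (hvb A ⟨le_rfl, hAb.le⟩) u, GM.no_hit hX hS (hvb b ⟨hAb.le, le_rfl⟩) u]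
        with ω hω hnt hnA hnb
      have i1 : (∃ t ∈ Icc A b, u ≤ X t ω) → E1.indicator (fun _ => (1:ℝ)) ω = 1 := fun h =>
        indicator_of_mem (show ω ∈ E1 from h) _
      have i0 : (¬ ∃ t ∈ Icc A b, u ≤ X t ω) → E1.indicator (fun _ => (1:ℝ)) ω = 0 := fun h =>
        indicator_of_notMem (show ω ∉ E1 from h) _
      have j1 : u ≤ X A ω → {ω | u ≤ X A ω}.indicator (fun _ => (1:ℝ)) ω = 1 := fun h =>
        indicator_of_mem (show ω ∈ {ω | u ≤ X A ω} from h) _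
      have j0 : ¬ u ≤ X A ω → {ω | u ≤ X A ω}.indicator (fun _ => (1:ℝ)) ω = 0 := fun h =>
        indicator_of_notMem (show ω ∉ {ω | u ≤ X A ω} from h) _
      by_cases hF : ∃ k ∈ GM.JJ A B b, 0 < GM.hull (GM.ZZ X A B) (GM.fam A B k) ω
      · refine le_trans ?_ le_add_self
        rw [indicator_of_mem (show ω ∈ {ω | ∃ k ∈ GM.JJ A B b, 0 < GM.hull (GM.ZZ X A B) (GM.fam A B k) ω} from hF)]
        exact GM.cross_F (f := fun t => X t ω) (f' := derivWithin (fun s => X s ω) (Icc A B)) hAb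
          (hω.continuousOn.mono hsub) M hMb _ _ i1 i0 j1 j0
      · refine le_trans ?_ le_self_add
        obtain ⟨f'', _, _, hd1, _⟩ := GM.c2_data hAB hω
        have hcc := GM.cross_concave (f := fun t => X t ω) (f' := derivWithin (fun s => X s ω) (Icc A B)) (u := u)
          hAb hbB hd1 (GM.concave_of_not_F X hAb hbB ω hω hF) hnA hnb hnt M hMb _ _
          ((toMeasurable P Bd).indicator (fun _ => (1:ℝ)) ω) i1 i0 j1 j0
          (indicator_nonneg (fun _ _ => zero_le_one) _) (by
            rintro ⟨t, ht, htM, h⟩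
            refine indicator_of_mem (subset_toMeasurable P Bd ?_) _
            exact ⟨t, hsub ht, lt_of_not_ge fun h2 => htM ⟨hsub ht, h2⟩, h.trans (le_abs_self _)⟩)
        refine (ENNReal.ofReal_le_ofReal hcc).trans ?_
        by_cases hb' : ω ∈ toMeasurable P Bd
        · rw [indicator_of_mem hb', indicator_of_mem hb']; simp
        · rw [indicator_of_notMem hb', indicator_of_notMem hb']; simp) (by
      rw [lintegral_add_left (measurable_const.indicator (measurableSet_toMeasurable _ _)),
        lintegral_indicator (measurableSet_toMeasurable _ _), setLIntegral_const, one_mul, measure_toMeasurable,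
        ENNReal.ofReal_add (by positivity) (by positivity)]
      exact add_le_add hB1u hB3u)
  rw [abs_le] at hstep1 hstep2
  have g1 := mul_le_mul_of_nonneg_left hx1 hC1.le
  have g2 := mul_le_mul_of_nonneg_left hx2 hC2.le
  have g3 := mul_le_mul_of_nonneg_left hx3 hC3.le
  rw [abs_le]
  rw [add_mul, add_mul, mul_assoc 3, mul_assoc 2]
  constructor <;> linarith [hstep1.1, hstep1.2, hstep2.1, hstep2.2]
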